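/- Every subgraph of the complete bipartite graph K_{10,14} that contains no K_{2,2} has at most 42 edges, and every subgraph of K_{10,14} that contains no K_{4,4} has at most 97 edges; that is, z((10,14), K_{2,2}) ≤ 42 and z((10,14), K_{4,4}) ≤ 97. -/

import Mathlib

/-- `G` (an edge set of a subgraph of `K_{m,n}`) contains `K_{s,t}`:
there are an `s`-subset `A` of the `X`-side and a `t`-subset `B` of the `Y`-side
with every pair in `A × B` an edge. -/
def ContainsK (m n s t : ℕ) (G : Finset (Fin m × Fin n)) : Prop :=
  ∃ A : Finset (Fin m), ∃ B : Finset (Fin n),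
    A.card = s ∧ B.card = t ∧ ∀ x ∈ A, ∀ y ∈ B, (x, y) ∈ G

/-- The bipartite complement of a subgraph of `K_{m,n}`. -/
def bipCompl (m n : ℕ) (G : Finset (Fin m × Fin n)) : Finset (Fin m × Fin n) :=
  Finset.univ \ G

/-- The neighborhood in `Y` of a vertex `x` of the `X`-side. -/
def nbhd (m n : ℕ) (G : Finset (Fin m × Fin n)) (x : Fin m) : Finset (Fin n) :=
  Finset.univ.filter (fun y => (x, y) ∈ G)

/-- The degree of a vertex `x` of the `X`-side. -/
def degX (m n : ℕ) (G : Finset (Fin m × Fin n)) (x : Fin m) : ℕ :=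
  (nbhd m n G x).card


def sixes : List ℕ := [
  783, 963, 315, 918, 937, 948, 573, 125, 126, 754, 629, 739, 717, 347, 159, 374, 190, 860, 711,
  869, 235, 455, 683, 996, 490, 821, 756, 839, 915, 795, 798, 377, 599, 249, 414, 760, 303, 621,
  909, 123, 430, 219, 245, 365, 679, 373, 917, 845, 1008, 977, 729, 938, 791, 813, 619, 663, 413,
  931, 378, 462, 797, 567, 634, 693, 469, 250, 940, 984, 231, 498, 972, 876, 399, 238, 444, 686,
  350, 822, 246, 243, 627, 603, 725, 467, 655, 753, 732, 934, 819, 311, 825, 189, 473, 343, 215,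
  873, 881, 874, 726, 438, 670, 857, 252, 1000, 718, 571, 888, 742, 978, 435, 741, 630, 222, 730,
  691, 187, 407, 748, 969, 437, 318, 853, 858, 441, 207, 669, 429, 606, 366, 807, 952, 921, 851,
  636, 483, 371, 470, 946, 870, 335, 814, 933, 965, 723, 543, 500, 591, 111, 993, 461, 476, 349,
  715, 922, 882, 884, 380, 846, 363, 697, 605, 237, 287, 95, 427, 907, 504, 119, 910, 854, 966,
  442, 175, 183, 980, 317, 746, 622, 828, 411, 497, 485, 843, 698, 359, 700, 903, 694, 492, 811,
  994, 459, 685, 667, 867, 945, 970, 474, 63, 924, 574, 423, 615, 826, 486, 221, 489, 559, 633, 745]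

def ones : ℕ := 636501202235239288314895592313098678138006209158560258172320384751572986496746287179954354257445786799475768634709041198477776886352600167166944938577317827602119792739992320045043832623689

def mask4 : ℕ := 2546004808940957153259582369252394712552024836634241032689281539006291945986985148719817417029783147197903074538836164793911107545410400668667779754309271310408479170959969280180175330494756

def hasL : List ℕ := [
  636482076590175277855732537458527141012466837773809413137876971372817980311851399246042724675118590797991673478531157608826214009751935426598373119188700083755624439655669650264387406270537,
  8721588830659455817958242390511614069233681578681776989957886753411807489436980428045852737727664171977264362953782119100662236291688162829436348612529995711456218767289112811533515096649,
  8855436114403543655137415356688745959580319429823280669710728132374865892674173596823165729257871905670058719019511179915947943629662886310397877037891043879806211691313876383896856461825,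
  636483907054205726151952291479480421759176878569420241921857670975660290006171237621897776231161104255269659334807101846533882410282942930031267402339152614468292412547390797451541000491073,
  69755419613885986771888003411863185291802754957577085793310045567400414976351525619907158058762603065601930985022201278321054769826010827147141305657493970108025686200521071631583137792576,
  636365230381269152347146721999727877867383718017486908918547865297540352763915155254776833998638501520878503020317017137059588633170345256085785999884326395700527761632150496034940229292096,
  627796874879663502667898486499281895976780288547323132796424842429586307391221229913740753559836534854534418321321745267801155737450573593463310975194316052131603007773818234389969978261512,
  558179324031114824285044655575782924126640592746274601768098947333532374117408756903008815495299992762931787925586361994267996110153598930039213332695210888419405114763135135190120430342664,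
  1106925301104225348136715710365853168463692818987397530997286687568765733530884361666929044376834648038423083814468410545288132395162092297692469304486874162369912048852575990593796215369,
  635260430614954034988478483996362409596508490511977709507140063959544760297916380133816116014495022813960892576880900348494871335163680898199050801549799047275607991359812970121696645517833]

def m1 : List ℕ := [
  1, 2, 4, 8, 16, 32, 64, 128, 256, 512]

def m2 : List ℕ := [
  3, 5, 9, 17, 33, 65, 129, 257, 513, 6, 10, 18, 34, 66, 130, 258, 514, 12, 20, 36, 68, 132, 260,
  516, 24, 40, 72, 136, 264, 520, 48, 80, 144, 272, 528, 96, 160, 288, 544, 192, 320, 576, 384,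
  640, 768]

def m3 : List ℕ := [
  7, 11, 19, 35, 67, 131, 259, 515, 13, 21, 37, 69, 133, 261, 517, 25, 41, 73, 137, 265, 521, 49,
  81, 145, 273, 529, 97, 161, 289, 545, 193, 321, 577, 385, 641, 769, 14, 22, 38, 70, 134, 262,
  518, 26, 42, 74, 138, 266, 522, 50, 82, 146, 274, 530, 98, 162, 290, 546, 194, 322, 578, 386,
  642, 770, 28, 44, 76, 140, 268, 524, 52, 84, 148, 276, 532, 100, 164, 292, 548, 196, 324, 580,
  388, 644, 772, 56, 88, 152, 280, 536, 104, 168, 296, 552, 200, 328, 584, 392, 648, 776, 112, 176,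
  304, 560, 208, 336, 592, 400, 656, 784, 224, 352, 608, 416, 672, 800, 448, 704, 832, 896]

def m4 : List ℕ := [
  15, 23, 39, 71, 135, 263, 519, 27, 43, 75, 139, 267, 523, 51, 83, 147, 275, 531, 99, 163, 291,
  547, 195, 323, 579, 387, 643, 771, 29, 45, 77, 141, 269, 525, 53, 85, 149, 277, 533, 101, 165,
  293, 549, 197, 325, 581, 389, 645, 773, 57, 89, 153, 281, 537, 105, 169, 297, 553, 201, 329, 585,
  393, 649, 777, 113, 177, 305, 561, 209, 337, 593, 401, 657, 785, 225, 353, 609, 417, 673, 801,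
  449, 705, 833, 897, 30, 46, 78, 142, 270, 526, 54, 86, 150, 278, 534, 102, 166, 294, 550, 198,
  326, 582, 390, 646, 774, 58, 90, 154, 282, 538, 106, 170, 298, 554, 202, 330, 586, 394, 650, 778,
  114, 178, 306, 562, 210, 338, 594, 402, 658, 786, 226, 354, 610, 418, 674, 802, 450, 706, 834,
  898, 60, 92, 156, 284, 540, 108, 172, 300, 556, 204, 332, 588, 396, 652, 780, 116, 180, 308, 564,
  212, 340, 596, 404, 660, 788, 228, 356, 612, 420, 676, 804, 452, 708, 836, 900, 120, 184, 312,
  568, 216, 344, 600, 408, 664, 792, 232, 360, 616, 424, 680, 808, 456, 712, 840, 904, 240, 368,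
  624, 432, 688, 816, 464, 720, 848, 912, 480, 736, 864, 928, 960]

def m5 : List ℕ := [
  31, 47, 79, 143, 271, 527, 55, 87, 151, 279, 535, 103, 167, 295, 551, 199, 327, 583, 391, 647,
  775, 59, 91, 155, 283, 539, 107, 171, 299, 555, 203, 331, 587, 395, 651, 779, 115, 179, 307, 563,
  211, 339, 595, 403, 659, 787, 227, 355, 611, 419, 675, 803, 451, 707, 835, 899, 61, 93, 157, 285,
  541, 109, 173, 301, 557, 205, 333, 589, 397, 653, 781, 117, 181, 309, 565, 213, 341, 597, 405,
  661, 789, 229, 357, 613, 421, 677, 805, 453, 709, 837, 901, 121, 185, 313, 569, 217, 345, 601,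
  409, 665, 793, 233, 361, 617, 425, 681, 809, 457, 713, 841, 905, 241, 369, 625, 433, 689, 817,
  465, 721, 849, 913, 481, 737, 865, 929, 961, 62, 94, 158, 286, 542, 110, 174, 302, 558, 206, 334,
  590, 398, 654, 782, 118, 182, 310, 566, 214, 342, 598, 406, 662, 790, 230, 358, 614, 422, 678,
  806, 454, 710, 838, 902, 122, 186, 314, 570, 218, 346, 602, 410, 666, 794, 234, 362, 618, 426,
  682, 810, 458, 714, 842, 906, 242, 370, 626, 434, 690, 818, 466, 722, 850, 914, 482, 738, 866,
  930, 962, 124, 188, 316, 572, 220, 348, 604, 412, 668, 796, 236, 364, 620, 428, 684, 812, 460,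
  716, 844, 908, 244, 372, 628, 436, 692, 820, 468, 724, 852, 916, 484, 740, 868, 932, 964, 248,
  376, 632, 440, 696, 824, 472, 728, 856, 920, 488, 744, 872, 936, 968, 496, 752, 880, 944, 976, 992]


def masksOf (s : ℕ) : List ℕ :=
  match s with
  | 0 => [0]
  | 1 => m1
  | 2 => m2
  | 3 => m3
  | 4 => m4
  | 5 => m5
  | _ => List.range 1024

/-- Evaluate `n` to a literal before continuing (controls kernel evaluation order). -/
noncomputable def force (n : ℕ) (k : ℕ → Bool) : Bool :=
  Nat.rec (k 0) (fun m _ => k (Nat.succ m)) n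

noncomputable def incAux (hs : List ℕ) : ℕ → ℕ → (ℕ → Bool) → Bool :=
  List.rec (motive := fun _ => ℕ → ℕ → (ℕ → Bool) → Bool)
    (fun _ acc k => k acc)
    (fun h _ ih m acc k =>
      Bool.rec (ih (Nat.div m 2) acc k)
        (force (Nat.land acc h) (fun a => ih (Nat.div m 2) a k))
        (Nat.beq (Nat.mod m 2) 1)) hs

/-- continuation-passing computation of the increment vector of a mask -/
noncomputable def incK (m : ℕ) (k : ℕ → Bool) : Bool := incAux hasL m ones k

noncomputable def okB (cnt c : ℕ) : Bool := Nat.beq (Nat.land (Nat.add cnt c) mask4) 0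

/-- filter a list of increments -/
noncomputable def filt (cnt : ℕ) (cs : List ℕ) : (List ℕ → Bool) → Bool :=
  List.rec (motive := fun _ => (List ℕ → Bool) → Bool)
    (fun k => k [])
    (fun c _ ih k => Bool.rec (ih k) (ih (fun r => k (c :: r))) (Nat.beq (Nat.land (Nat.add cnt c) mask4) 0)) cs

/-- filter a list of masks, returning increments -/
noncomputable def filtI (cnt : ℕ) (cs : List ℕ) : (List ℕ → Bool) → Bool :=
  List.rec (motive := fun _ => (List ℕ → Bool) → Bool)
    (fun k => k [])
    (fun m _ ih k => incK m (fun c =>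
      Bool.rec (ih k) (ih (fun r => k (c :: r))) (Nat.beq (Nat.land (Nat.add cnt c) mask4) 0))) cs

/-- filter a list of masks, returning masks -/
noncomputable def filtM (cnt : ℕ) (cs : List ℕ) : (List ℕ → Bool) → Bool :=
  List.rec (motive := fun _ => (List ℕ → Bool) → Bool)
    (fun k => k [])
    (fun m _ ih k => incK m (fun c =>
      Bool.rec (ih k) (ih (fun r => k (m :: r))) (Nat.beq (Nat.land (Nat.add cnt c) mask4) 0))) cs

noncomputable def andB (a b : Bool) : Bool := Bool.rec false b a

noncomputable def loop (cnt : ℕ) (ih : ℕ → List ℕ → Bool) (cs : List ℕ) : Bool :=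
  List.rec (motive := fun _ => Bool) true
    (fun c tl r => Bool.rec false r
      (force (Nat.add cnt c) (fun cnt' => filt cnt' (c :: tl) (fun l => ih cnt' l)))) cs

noncomputable def dfs (next : ℕ → Bool) (n : ℕ) : ℕ → List ℕ → Bool :=
  Nat.rec (motive := fun _ => ℕ → List ℕ → Bool)
    (fun cnt _ => next cnt)
    (fun _ ih cnt cs => loop cnt ih cs) n

noncomputable def runP (ps : List (ℕ × ℕ)) : ℕ → Bool :=
  List.rec (motive := fun _ => ℕ → Bool) (fun _ => false)
    (fun p _ ih cnt => filtI cnt (masksOf p.1) (fun l => dfs ih p.2 cnt l)) ps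

noncomputable def cntK (S : List ℕ) : ℕ → (ℕ → Bool) → Bool :=
  List.rec (motive := fun _ => ℕ → (ℕ → Bool) → Bool)
    (fun acc k => k acc)
    (fun m _ ih acc k => incK m (fun c => force (Nat.add acc c) (fun a => ih a k))) S

def swapM (a b m : ℕ) : ℕ :=
  bif Nat.beq (Nat.land (Nat.shiftRight m a) 1) (Nat.land (Nat.shiftRight m b) 1) then m
  else Nat.xor m (Nat.lor (Nat.pow 2 a) (Nat.pow 2 b))

def permM (g : List (ℕ × ℕ)) (m : ℕ) : ℕ := g.foldl (fun m p => swapM p.1 p.2 m) m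

/-- value added to a bitmap for the element `m`: the bit `64 + m`, together with low bits
serving as a hash value (kernel caches hash numerals by their low 64 bits) -/
def bitV (m : ℕ) : ℕ := Nat.xor (Nat.pow 2 (Nat.add m 64)) (Nat.mod (Nat.pow m 6) 18446744073709551616)

def bitB (B i : ℕ) : Bool := Nat.beq (Nat.land (Nat.shiftRight B (Nat.add i 64)) 1) 1

noncomputable def bitmapK (C : List ℕ) : ℕ → (ℕ → Bool) → Bool :=
  List.rec (motive := fun _ => ℕ → (ℕ → Bool) → Bool)
    (fun acc k => k acc)
    (fun m _ ih acc k => force (Nat.xor acc (bitV m)) (fun a => ih a k)) C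

/-- one pass: collect into the orbit those elements having an image in the orbit;
pass the orbit bitmap and the list of the others on -/
noncomputable def passK (gens : List (List (ℕ × ℕ))) (C : List ℕ) :
    ℕ → (ℕ → List ℕ → Bool) → Bool :=
  List.rec (motive := fun _ => ℕ → (ℕ → List ℕ → Bool) → Bool)
    (fun acc k => k acc [])
    (fun m _ ih acc k =>
      Bool.rec
        (Bool.rec (ih acc (fun a r => k a (m :: r)))
          (force (Nat.xor acc (bitV m)) (fun a => ih a k))
          (gens.any (fun g => bitB acc (permM g m))))
        (ih acc k)
        (bitB acc m)) C

noncomputable def orbK (gens : List (List (ℕ × ℕ))) (fuel : ℕ) :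
    ℕ → List ℕ → (List ℕ → Bool) → Bool :=
  Nat.rec (motive := fun _ => ℕ → List ℕ → (List ℕ → Bool) → Bool)
    (fun _ C k => k C)
    (fun _ ih acc C k => passK gens C acc (fun acc' C' =>
      Bool.rec (ih acc' C' k) (k C') (Nat.beq acc' acc))) fuel

inductive CTree where
  | leaf : CTree
  | orb : ℕ → List (List (ℕ × ℕ)) → CTree → CTree → CTree

def gensOK (gens : List (List (ℕ × ℕ))) (S C : List ℕ) (B : ℕ) : Bool :=
  gens.all (fun g => g.all (fun p => Nat.blt p.1 10 && Nat.blt p.2 10)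
    && (S.map (permM g)).isPerm S && C.all (fun m => bitB B (permM g m)))

noncomputable def advance (C : List ℕ) (n : ℕ) (ps : List (ℕ × ℕ))
    (k : List ℕ → ℕ → List (ℕ × ℕ) → Bool) : Bool :=
  match n with
  | 0 => match ps with
    | [] => false
    | p :: ps => k (masksOf p.1) p.2 ps
  | n + 1 => k C (n + 1) ps

noncomputable def check (t : CTree) : List ℕ → List ℕ → ℕ → List (ℕ × ℕ) → Bool :=
  CTree.rec (motive := fun _ => List ℕ → List ℕ → ℕ → List (ℕ × ℕ) → Bool)
    (fun S C n ps => cntK S 0 (fun cnt => filtI cnt C (fun l => dfs (runP ps) n cnt l)))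
    (fun r gens _ _ iha ihb S C n ps =>
      advance C n ps (fun C n ps => cntK S 0 (fun cnt => filtM cnt C (fun C =>
        Nat.rec false (fun n' _ =>
          bitmapK C 0 (fun B => 
          andB (gensOK gens S C B)
          (andB (bitB B r)
          (andB (iha (r :: S) C n' ps)
            (orbK gens 12 (bitV r) C (fun C' => ihb S C' (n' + 1) ps)))))) n)))) t

/-! ### Semantics -/

/-- the subset of `Fin 10` coded by a mask -/
def dec (m : ℕ) : Finset (Fin 10) := Finset.univ.filter (fun i => m.testBit i.val = true)

/-- every 6-subset contains at most three members of the list -/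
def R4 (L : List (Finset (Fin 10))) : Prop :=
  ∀ V : Finset (Fin 10), V.card = 6 → L.countP (fun s => decide (s ⊆ V)) ≤ 3

theorem R4.perm {L L' : List (Finset (Fin 10))} (h : L.Perm L') (hL : R4 L) : R4 L' := by
  intro V hV
  rw [← h.countP_eq]
  exact hL V hV

theorem R4.sub {L L' : List (Finset (Fin 10))} (h : L'.Sublist L) (hL : R4 L) : R4 L' := by
  intro V hV
  exact le_trans h.countP_le (hL V hV)

theorem R4.map (σ : Equiv.Perm (Fin 10)) {L : List (Finset (Fin 10))} (hL : R4 L) :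
    R4 (L.map (fun s => s.map σ.toEmbedding)) := by
  intro V hV
  have h := hL (V.map σ.symm.toEmbedding) (by simpa using hV)
  rw [List.countP_map]
  refine le_trans (le_of_eq ?_) h
  apply List.countP_congr
  intro s _
  simp only [Function.comp, decide_eq_true_eq]
  rw [Finset.map_subset_iff_subset_preimage]
  constructor
  · intro hh x hx
    have := hh hx
    simp only [Finset.mem_preimage] at this
    simp only [Finset.mem_map_equiv]
    simpa using this
  · intro hh x hx
    have := hh hx
    simp only [Finset.mem_map_equiv] at this
    simp only [Finset.mem_preimage]
    simpa using this

/-! ### Packed counters -/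

def pk (f : ℕ → ℕ) : List ℕ → ℕ
  | [] => 0
  | V :: Vs => f V + 8 * pk f Vs

theorem pk_add (f g : ℕ → ℕ) (Vs : List ℕ) :
    pk f Vs + pk g Vs = pk (fun V => f V + g V) Vs := by
  induction Vs with
  | nil => rfl
  | cons V Vs ih => simp only [pk, ← ih]; ring

theorem pk_land (f g : ℕ → ℕ) (Vs : List ℕ) (hf : ∀ V ∈ Vs, f V < 8) (hg : ∀ V ∈ Vs, g V < 8) :
    pk f Vs &&& pk g Vs = pk (fun V => f V &&& g V) Vs := by
  induction Vs with
  | nil => simp [pk]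
  | cons V Vs ih =>
    have h1 := hf V (by simp)
    have h2 := hg V (by simp)
    have ih' := ih (fun W hW => hf W (by simp [hW])) (fun W hW => hg W (by simp [hW]))
    simp only [pk]
    have e1 := Nat.and_div_two_pow (a := f V + 8 * pk f Vs) (b := g V + 8 * pk g Vs) (n := 3)
    have e2 := Nat.and_mod_two_pow (a := f V + 8 * pk f Vs) (b := g V + 8 * pk g Vs) (n := 3)
    have a1 : (f V + 8 * pk f Vs) / 2 ^ 3 = pk f Vs := by omega
    have a2 : (g V + 8 * pk g Vs) / 2 ^ 3 = pk g Vs := by omega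
    have a3 : (f V + 8 * pk f Vs) % 2 ^ 3 = f V := by omega
    have a4 : (g V + 8 * pk g Vs) % 2 ^ 3 = g V := by omega
    rw [a1, a2, ih'] at e1
    rw [a3, a4] at e2
    omega

theorem pk_zero (f : ℕ → ℕ) (Vs : List ℕ) (h : ∀ V ∈ Vs, f V = 0) : pk f Vs = 0 := by
  induction Vs with
  | nil => rfl
  | cons V Vs ih =>
    simp only [pk, h V (by simp), ih (fun W hW => h W (by simp [hW]))]

def pkb (p : ℕ → Bool) : ℕ := pk (fun V => (p V).toNat) sixes

theorem pkb_land (p q : ℕ → Bool) : pkb p &&& pkb q = pkb (fun V => p V && q V) := by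
  unfold pkb
  rw [pk_land]
  · congr 1
    funext V
    show (p V).toNat &&& (q V).toNat = (p V && q V).toNat
    cases p V <;> cases q V <;> decide
  · intro V _
    cases p V <;> decide
  · intro V _
    cases q V <;> decide

theorem hasL_eq : hasL = (List.range' 0 10).map (fun i => pkb (fun V => V.testBit i)) := by
  decide +kernel

theorem ones_eq : ones = pkb (fun _ => true) := by decide +kernel

theorem mask4_eq : mask4 = pk (fun _ => 4) sixes := by decide +kernel

theorem sixes_card : ∀ V ∈ sixes, (dec V).card = 6 := by decide +kernel

/-! ### Increments -/

theorem force_eq (n : ℕ) (k : ℕ → Bool) : force n k = k n := by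
  cases n <;> rfl

def incF : List ℕ → ℕ → ℕ → ℕ
  | [], _, acc => acc
  | h :: hs, m, acc => incF hs (m / 2) (bif Nat.beq (m % 2) 1 then acc &&& h else acc)

theorem incAux_eq (hs : List ℕ) : ∀ (m acc : ℕ) (k : ℕ → Bool),
    incAux hs m acc k = k (incF hs m acc) := by
  induction hs with
  | nil => intro m acc k; rfl
  | cons h hs ih =>
    intro m acc k
    have : incAux (h :: hs) m acc k =
      Bool.rec (incAux hs (m / 2) acc k)
        (force (acc &&& h) (fun a => incAux hs (m / 2) a k)) (Nat.beq (m % 2) 1) := rfl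
    rw [this, incF]
    cases Nat.beq (m % 2) 1
    · exact ih _ _ _
    · exact (force_eq _ _).trans (ih _ _ _)

def incV (m : ℕ) : ℕ := incF hasL m ones

theorem incK_eq (m : ℕ) (k : ℕ → Bool) : incK m k = k (incV m) := incAux_eq _ _ _ _

def qF : List ℕ → ℕ → ℕ → Bool
  | [], _, _ => true
  | i :: is, m, V => (!(Nat.beq (m % 2) 1) || V.testBit i) && qF is (m / 2) V

theorem incF_eq (is : List ℕ) : ∀ (m : ℕ) (p : ℕ → Bool),
    incF (is.map (fun i => pkb (fun V => V.testBit i))) m (pkb p)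
      = pkb (fun V => p V && qF is m V) := by
  induction is with
  | nil => intro m p; simp [incF, qF]
  | cons i is ih =>
    intro m p
    simp only [List.map_cons, incF, qF]
    cases h : Nat.beq (m % 2) 1
    · simp only [cond_false, Bool.not_false, Bool.true_or, Bool.true_and]
      exact ih _ _
    · simp only [cond_true, Bool.not_true, Bool.false_or]
      rw [pkb_land, ih]
      simp only [Bool.and_assoc]

theorem qF_range (n : ℕ) : ∀ (j m V : ℕ), qF (List.range' j n) m V = true →
    ∀ i, i < n → m.testBit i = true → V.testBit (j + i) = true := by
  induction n with
  | zero => intro j m V _ i hi; omega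
  | succ n ih =>
    intro j m V h i hi hm
    rw [List.range'_succ] at h
    simp only [qF, Bool.and_eq_true, Bool.or_eq_true, Bool.not_eq_true'] at h
    cases i with
    | zero =>
      have hm' : m % 2 = 1 := by simpa [Nat.testBit_zero] using hm
      rcases h.1 with h1 | h1
      · rw [hm'] at h1
        exact absurd h1 (by decide)
      · simpa using h1
    | succ i =>
      have := ih (j + 1) (m / 2) V h.2 i (by omega) (by rw [← Nat.testBit_succ]; exact hm)
      rw [show j + (i + 1) = j + 1 + i by ring]
      exact this

def qq (m V : ℕ) : Bool := qF (List.range' 0 10) m V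

theorem incV_eq (m : ℕ) : incV m = pkb (qq m) := by
  unfold incV
  rw [hasL_eq, ones_eq, incF_eq]
  simp only [Bool.true_and]
  rfl

theorem qq_sub {m V : ℕ} (h : qq m V = true) : dec m ⊆ dec V := by
  intro i hi
  simp only [dec, Finset.mem_filter, Finset.mem_univ, true_and] at hi ⊢
  have := qF_range 10 0 m V h i.val i.isLt hi
  simpa using this

def cntV (L : List ℕ) : ℕ := (L.map incV).sum

theorem cntV_cons (m : ℕ) (L : List ℕ) : cntV (m :: L) = incV m + cntV L := by
  simp [cntV]

theorem cntV_eq (L : List ℕ) : cntV L = pk (fun V => L.countP (fun m => qq m V)) sixes := by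
  induction L with
  | nil =>
    rw [pk_zero]
    · rfl
    · intro V _; rfl
  | cons m L ih =>
    rw [cntV_cons, ih, incV_eq, pkb, pk_add]
    congr 1
    funext V
    rw [List.countP_cons]
    cases qq m V <;> simp [Nat.add_comm]

theorem ok_of_R4 {L : List ℕ} (h : R4 (L.map dec)) : cntV L &&& mask4 = 0 := by
  have key : ∀ V ∈ sixes, L.countP (fun m => qq m V) ≤ 3 := by
    intro V hV
    refine le_trans ?_ (h (dec V) (sixes_card V hV))
    rw [List.countP_map]
    apply List.countP_mono_left
    intro m _ hm
    simp only [Function.comp, decide_eq_true_eq]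
    exact qq_sub hm
  rw [cntV_eq, mask4_eq, pk_land]
  · apply pk_zero
    intro V hV
    have := key V hV
    generalize L.countP (fun m => qq m V) = c at this
    interval_cases c <;> rfl
  · intro V hV
    have := key V hV
    omega
  · intro V _
    norm_num

theorem okB_of_R4 {m : ℕ} {L : List ℕ} (h : R4 ((m :: L).map dec)) :
    okB (cntV L) (incV m) = true := by
  have := ok_of_R4 h
  rw [cntV_cons, Nat.add_comm] at this
  unfold okB
  exact Nat.beq_eq.mpr this

/-! ### Filters -/

theorem filt_eq (cnt : ℕ) (cs : List ℕ) : ∀ k, filt cnt cs k = k (cs.filter (okB cnt)) := by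
  induction cs with
  | nil => intro k; rfl
  | cons c cs ih =>
    intro k
    have : filt cnt (c :: cs) k =
      Bool.rec (filt cnt cs k) (filt cnt cs (fun r => k (c :: r))) (okB cnt c) := rfl
    rw [this, List.filter_cons]
    cases okB cnt c
    · exact ih _
    · exact ih _

theorem filtI_eq (cnt : ℕ) (cs : List ℕ) :
    ∀ k, filtI cnt cs k = k ((cs.map incV).filter (okB cnt)) := by
  induction cs with
  | nil => intro k; rfl
  | cons c cs ih =>
    intro k
    have : filtI cnt (c :: cs) k = incK c (fun c =>
      Bool.rec (filtI cnt cs k) (filtI cnt cs (fun r => k (c :: r))) (okB cnt c)) := rfl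
    rw [this, incK_eq, List.map_cons, List.filter_cons]
    cases okB cnt (incV c)
    · exact ih _
    · exact ih _

theorem filtM_eq (cnt : ℕ) (cs : List ℕ) :
    ∀ k, filtM cnt cs k = k (cs.filter (fun m => okB cnt (incV m))) := by
  induction cs with
  | nil => intro k; rfl
  | cons c cs ih =>
    intro k
    have : filtM cnt (c :: cs) k = incK c (fun d =>
      Bool.rec (filtM cnt cs k) (filtM cnt cs (fun r => k (c :: r))) (okB cnt d)) := rfl
    rw [this, incK_eq, List.filter_cons]
    cases okB cnt (incV c)
    · exact ih _
    · exact ih _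

theorem cntK_eq (S : List ℕ) : ∀ acc k, cntK S acc k = k (acc + cntV S) := by
  induction S with
  | nil => intro acc k; simp [cntV]; rfl
  | cons m S ih =>
    intro acc k
    have : cntK (m :: S) acc k = incK m (fun c => force (acc + c) (fun a => cntK S a k)) := rfl
    rw [this, incK_eq, force_eq, ih, cntV_cons, Nat.add_assoc]

/-! ### Soundness of the search -/

def expandP : List (ℕ × ℕ) → List ℕ
  | [] => []
  | p :: ps => List.replicate p.2 p.1 ++ expandP ps

def Bad (ps : List (ℕ × ℕ)) (L : List ℕ) : Prop :=
  ∀ R : List (Finset (Fin 10)), R.map Finset.card = expandP ps → ¬ R4 (L.map dec ++ R)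

theorem Bad.perm {ps : List (ℕ × ℕ)} {L L' : List ℕ} (h : L.Perm L') (hL : Bad ps L) :
    Bad ps L' := by
  intro R hR h4
  exact hL R hR (R4.perm ((h.map dec).symm.append_right R) h4)

theorem Bad.of_sub {ps : List (ℕ × ℕ)} {L L' : List ℕ} (h : L'.Subperm L)
    (hL : ¬ R4 (L'.map dec)) : Bad ps L := by
  intro R _ h4
  apply hL
  obtain ⟨L'', h1, h2⟩ := h
  have h3 : R4 (L''.map dec) :=
    R4.sub ((h2.map dec).trans (List.sublist_append_left _ _)) h4
  exact R4.perm (h1.map dec) h3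

theorem dfs_sound (ps : List (ℕ × ℕ)) (next : ℕ → Bool)
    (hnext : ∀ L, next (cntV L) = true → Bad ps L) (n : ℕ) :
    ∀ (L cs : List ℕ), dfs next n (cntV L) cs = true →
      ∀ T : List ℕ, T.length = n → (∀ t ∈ T, incV t ∈ cs) → Bad ps (T ++ L) := by
  induction n with
  | zero =>
    intro L cs h T hT _
    rw [List.length_eq_zero_iff] at hT
    subst hT
    exact hnext L h
  | succ n ih =>
    intro L cs h
    have h' : loop (cntV L) (dfs next n) cs = true := h
    clear h
    induction cs with
    | nil =>
      intro T hT hmem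
      cases T with
      | nil => simp at hT
      | cons t T => exact absurd (hmem t (by simp)) (by simp)
    | cons c tl ihl =>
      intro T hT hmem
      have e : loop (cntV L) (dfs next n) (c :: tl) =
        Bool.rec false (loop (cntV L) (dfs next n) tl)
          (force (cntV L + c) (fun cnt' => filt cnt' (c :: tl) (fun l => dfs next n cnt' l))) := rfl
      rw [e, force_eq, filt_eq] at h'
      cases hb : dfs next n (cntV L + c) (List.filter (okB (cntV L + c)) (c :: tl)) with
      | false => rw [hb] at h'; exact Bool.noConfusion h'
      | true =>
        rw [hb] at h'
        have hr : loop (cntV L) (dfs next n) tl = true := h'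
        by_cases hc : ∃ t ∈ T, incV t = c
        · obtain ⟨t, htT, htc⟩ := hc
          have hp := List.perm_cons_erase htT
          set T' := T.erase t with hT'
          have hcnt : cntV L + c = cntV (t :: L) := by rw [cntV_cons, htc, Nat.add_comm]
          have hp2 : (T' ++ t :: L).Perm (T ++ L) := by
            refine List.perm_middle.trans ?_
            exact (hp.symm.append_right L)
          apply Bad.perm hp2
          by_cases hall : ∀ t' ∈ T', okB (cntV (t :: L)) (incV t') = true
          · rw [hcnt] at hb
            refine ih (t :: L) _ hb T' ?_ ?_
            · have := hp.length_eq
              simp only [List.length_cons] at this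
              omega
            · intro t' ht'
              rw [List.mem_filter]
              exact ⟨hmem t' (List.mem_of_mem_erase ht'), hall t' ht'⟩
          · push Not at hall
            obtain ⟨t', ht', hno⟩ := hall
            refine Bad.of_sub (L' := t' :: t :: L) ?_ ?_
            · have : ([t'] ++ (t :: L)).Subperm (T' ++ (t :: L)) := by
                refine List.Sublist.subperm ?_
                exact List.Sublist.append_right (List.singleton_sublist.mpr ht') _
              exact this
            · intro h4
              exact hno (okB_of_R4 h4)
        · apply ihl hr T hT
          intro t ht
          have := hmem t ht
          rw [List.mem_cons] at this
          rcases this with h1 | h1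
          · exact absurd ⟨t, ht, h1⟩ hc
          · exact h1

theorem masksOf_aux : ∀ m ∈ List.range 1024, m ∈ masksOf (dec m).card := by
  decide +kernel

def enc (X : Finset (Fin 10)) : ℕ := ∑ i ∈ X, 2 ^ i.val

theorem exists_dec (X : Finset (Fin 10)) : ∃ m ∈ masksOf X.card, dec m = X := by
  have : ∃ m ∈ List.range 1024, dec m = X := by
    refine ⟨Nat.ofBits (fun i : Fin 10 => decide (i ∈ X)), ?_, ?_⟩
    · rw [List.mem_range]
      exact Nat.ofBits_lt_two_pow _
    · ext i
      simp [dec, Nat.testBit_ofBits_lt]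
  obtain ⟨m, hm, rfl⟩ := this
  exact ⟨m, masksOf_aux m hm, rfl⟩

theorem exists_dec_list (s : ℕ) (R : List (Finset (Fin 10))) (h : ∀ X ∈ R, X.card = s) :
    ∃ T : List ℕ, T.map dec = R ∧ ∀ t ∈ T, t ∈ masksOf s := by
  induction R with
  | nil => exact ⟨[], rfl, by simp⟩
  | cons X R ih =>
    obtain ⟨T, h1, h2⟩ := ih (fun Y hY => h Y (by simp [hY]))
    obtain ⟨m, hm, hd⟩ := exists_dec X
    rw [h X (by simp)] at hm
    refine ⟨m :: T, by simp [hd, h1], ?_⟩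
    intro t ht
    rw [List.mem_cons] at ht
    rcases ht with rfl | ht
    · exact hm
    · exact h2 t ht

def Inf (S C : List ℕ) (n : ℕ) (ps : List (ℕ × ℕ)) : Prop :=
  ∀ T : List ℕ, T.length = n → (∀ t ∈ T, t ∈ C) → Bad ps (T ++ S)

theorem Bad_cons_of_Inf {S : List ℕ} {p : ℕ × ℕ} {ps : List (ℕ × ℕ)}
    (h : Inf S (masksOf p.1) p.2 ps) : Bad (p :: ps) S := by
  intro R hR h4
  rw [expandP] at hR
  obtain ⟨R1, R2, rfl, h1, h2⟩ := List.map_eq_append_iff.mp hR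
  have hc : ∀ X ∈ R1, X.card = p.1 := by
    intro X hX
    have : X.card ∈ R1.map Finset.card := List.mem_map_of_mem hX
    rw [h1] at this
    exact List.eq_of_mem_replicate this
  obtain ⟨T, rfl, hT⟩ := exists_dec_list p.1 R1 hc
  have hl : T.length = p.2 := by
    have := congrArg List.length h1
    simpa using this
  refine h T hl hT R2 h2 (R4.perm ?_ h4)
  rw [List.map_append, ← List.append_assoc]
  exact List.perm_append_comm.append_right _

theorem Inf_of_filter {S C : List ℕ} {n : ℕ} {ps : List (ℕ × ℕ)}
    (h : Inf S (C.filter (fun m => okB (cntV S) (incV m))) n ps) : Inf S C n ps := by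
  intro T hT hm
  by_cases hall : ∀ t ∈ T, okB (cntV S) (incV t) = true
  · exact h T hT (fun t ht => List.mem_filter.mpr ⟨hm t ht, hall t ht⟩)
  · push Not at hall
    obtain ⟨t, ht, hno⟩ := hall
    refine Bad.of_sub (L' := t :: S) ?_ (fun h4 => hno (okB_of_R4 h4))
    have : ([t] ++ S).Subperm (T ++ S) :=
      (List.Sublist.append_right (List.singleton_sublist.mpr ht) _).subperm
    exact this

theorem leaf_sound {ps : List (ℕ × ℕ)} {next : ℕ → Bool}
    (hnext : ∀ L, next (cntV L) = true → Bad ps L) {n : ℕ} {S C : List ℕ}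
    (h : filtI (cntV S) C (fun l => dfs next n (cntV S) l) = true) : Inf S C n ps := by
  rw [filtI_eq] at h
  apply Inf_of_filter
  intro T hT hm
  refine dfs_sound ps next hnext n S _ h T hT ?_
  intro t ht
  have := List.mem_filter.mp (hm t ht)
  exact List.mem_filter.mpr ⟨List.mem_map_of_mem this.1, this.2⟩

theorem runP_sound (ps : List (ℕ × ℕ)) : ∀ L, runP ps (cntV L) = true → Bad ps L := by
  induction ps with
  | nil => intro L h; exact absurd h (by simp [runP])
  | cons p ps ih =>
    intro L h
    exact Bad_cons_of_Inf (leaf_sound ih h)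

/-! ### Relabellings -/

theorem bitB_iff (B i : ℕ) : bitB B i = true ↔ B.testBit (i + 64) = true := by
  have : bitB B i = Nat.beq ((B >>> (i + 64)) &&& 1) 1 := rfl
  rw [this, Nat.beq_eq, Nat.testBit, Nat.and_comm]
  have h : 1 &&& B >>> (i + 64) = (B >>> (i + 64)) % 2 := by
    rw [Nat.and_comm, Nat.and_one_is_mod]
  rw [h]
  rcases Nat.mod_two_eq_zero_or_one (B >>> (i + 64)) with h | h <;> simp [h]

theorem bitB_xor {acc m j : ℕ} (h : bitB (Nat.xor acc (bitV m)) j = true) :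
    bitB acc j = true ∨ j = m := by
  rw [bitB_iff] at h ⊢
  have e : Nat.xor acc (bitV m) = acc ^^^ (2 ^ (m + 64) ^^^ (m ^ 6 % 2 ^ 64)) := rfl
  rw [e, Nat.testBit_xor, Nat.testBit_xor, Nat.testBit_mod_two_pow, Nat.testBit_two_pow] at h
  by_cases hj : j = m
  · exact Or.inr hj
  · left
    have h1 : ¬ (j + 64 < 64) := by omega
    have h2 : ¬ (m + 64 = j + 64) := by omega
    have h3 : ¬ (m = j) := fun h => hj h.symm
    simpa [h1, h2, h3] using h

theorem bitB_zero (j : ℕ) : ¬ bitB 0 j = true := by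
  rw [bitB_iff]; simp

theorem bitmapK_sound (C : List ℕ) : ∀ acc k, bitmapK C acc k = true →
    ∃ B, k B = true ∧ ∀ j, bitB B j = true → bitB acc j = true ∨ j ∈ C := by
  induction C with
  | nil => intro acc k h; exact ⟨acc, h, fun j hj => Or.inl hj⟩
  | cons m C ih =>
    intro acc k h
    have e : bitmapK (m :: C) acc k = force (Nat.xor acc (bitV m)) (fun a => bitmapK C a k) := rfl
    rw [e, force_eq] at h
    obtain ⟨B, h1, h2⟩ := ih _ _ h
    refine ⟨B, h1, fun j hj => ?_⟩
    rcases h2 j hj with h3 | h3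
    · rcases bitB_xor h3 with h4 | h4
      · exact Or.inl h4
      · exact Or.inr (by simp [h4])
    · exact Or.inr (by simp [h3])

theorem bitNat (m a : ℕ) : Nat.land (Nat.shiftRight m a) 1 = (m.testBit a).toNat := by
  have : Nat.land (Nat.shiftRight m a) 1 = (m >>> a) &&& 1 := rfl
  rw [this, Nat.testBit, Nat.and_comm]
  have h : 1 &&& m >>> a = (m >>> a) % 2 := by
    rw [Nat.and_comm, Nat.and_one_is_mod]
  rw [h]
  rcases Nat.mod_two_eq_zero_or_one (m >>> a) with h | h <;> simp [h]

theorem dec_swapM (a b : Fin 10) (m : ℕ) :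
    dec (swapM a b m) = (dec m).map (Equiv.swap a b).toEmbedding := by
  ext i
  rw [Finset.mem_map_equiv, Equiv.symm_swap]
  simp only [dec, Finset.mem_filter, Finset.mem_univ, true_and]
  unfold swapM
  rw [bitNat, bitNat]
  by_cases hab : m.testBit a = m.testBit b
  · rw [hab]
    have : Nat.beq (m.testBit b).toNat (m.testBit b).toNat = true := by simp
    rw [this, cond_true]
    by_cases h1 : i = a
    · subst h1; rw [Equiv.swap_apply_left, hab]
    · by_cases h2 : i = b
      · subst h2; rw [Equiv.swap_apply_right, hab]
      · rw [Equiv.swap_apply_of_ne_of_ne h1 h2]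
  · have hne : a ≠ b := by rintro rfl; exact hab rfl
    have hv : a.val ≠ b.val := fun h => hne (Fin.ext h)
    have : Nat.beq (m.testBit a).toNat (m.testBit b).toNat = false := by
      cases h1 : m.testBit a <;> cases h2 : m.testBit b <;> simp_all <;> rfl
    rw [this, cond_false]
    have e : Nat.xor m (Nat.lor (Nat.pow 2 a) (Nat.pow 2 b)) = m ^^^ (2 ^ a.val ||| 2 ^ b.val) := rfl
    rw [e, Nat.testBit_xor, Nat.testBit_or, Nat.testBit_two_pow, Nat.testBit_two_pow]
    by_cases h1 : i = a
    · subst h1; rw [Equiv.swap_apply_left]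
      cases h1 : m.testBit i <;> cases h2 : m.testBit b <;> simp_all
    · have h1v : a.val ≠ i.val := fun h => h1 (Fin.ext h.symm)
      by_cases h2 : i = b
      · subst h2; rw [Equiv.swap_apply_right]
        cases h1 : m.testBit a <;> cases h2 : m.testBit i <;> simp_all
      · have h2v : b.val ≠ i.val := fun h => h2 (Fin.ext h.symm)
        rw [Equiv.swap_apply_of_ne_of_ne h1 h2]
        simp [h1v, h2v]

theorem dec_permM (g : List (ℕ × ℕ)) (hg : ∀ p ∈ g, p.1 < 10 ∧ p.2 < 10) :
    ∃ σ : Equiv.Perm (Fin 10), ∀ m, dec (permM g m) = (dec m).map σ.toEmbedding := by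
  induction g with
  | nil => exact ⟨Equiv.refl _, fun m => by ext i; simp [permM]⟩
  | cons p g ih =>
    obtain ⟨σ, hσ⟩ := ih (fun q hq => hg q (by simp [hq]))
    obtain ⟨h1, h2⟩ := hg p (by simp)
    refine ⟨(Equiv.swap (⟨p.1, h1⟩ : Fin 10) ⟨p.2, h2⟩).trans σ, fun m => ?_⟩
    have e : permM (p :: g) m = permM g (swapM p.1 p.2 m) := rfl
    rw [e, hσ]
    have := dec_swapM ⟨p.1, h1⟩ ⟨p.2, h2⟩ m
    rw [this, Finset.map_map]
    rfl

theorem passK_sound (Gd : ℕ → Prop) (gens : List (List (ℕ × ℕ))) (C : List ℕ)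
    (hstep : ∀ c ∈ C, ∀ g ∈ gens, Gd (permM g c) → Gd c) :
    ∀ acc k, (∀ j, bitB acc j = true → Gd j) → passK gens C acc k = true →
      ∃ acc' C', k acc' C' = true ∧ (∀ j, bitB acc' j = true → Gd j) ∧ (∀ c ∈ C', c ∈ C) ∧
        ∀ c ∈ C, c ∈ C' ∨ Gd c := by
  induction C with
  | nil => intro acc k ha h; exact ⟨acc, [], h, ha, by simp, by simp⟩
  | cons m C ih =>
    intro acc k ha h
    have hs' : ∀ c ∈ C, ∀ g ∈ gens, Gd (permM g c) → Gd c := fun c hc => hstep c (by simp [hc])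
    have e : passK gens (m :: C) acc k = Bool.rec
        (Bool.rec (passK gens C acc (fun a r => k a (m :: r)))
          (force (Nat.xor acc (bitV m)) (fun a => passK gens C a k))
          (gens.any (fun g => bitB acc (permM g m))))
        (passK gens C acc k)
        (bitB acc m) := rfl
    rw [e] at h
    cases h1 : bitB acc m with
    | true =>
      rw [h1] at h
      obtain ⟨acc', C', a1, a2, a3, a4⟩ := ih hs' acc k ha h
      refine ⟨acc', C', a1, a2, fun c hc => by simp [a3 c hc], fun c hc => ?_⟩
      rw [List.mem_cons] at hc
      rcases hc with rfl | hc
      · exact Or.inr (ha _ h1)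
      · exact a4 c hc
    | false =>
      rw [h1] at h
      cases h2 : gens.any (fun g => bitB acc (permM g m)) with
      | true =>
        rw [h2] at h
        have hG : Gd m := by
          rw [List.any_eq_true] at h2
          obtain ⟨g, hg, hb⟩ := h2
          exact hstep m (by simp) g hg (ha _ hb)
        have h' : passK gens C (Nat.xor acc (bitV m)) k = true := by
          have : force (Nat.xor acc (bitV m)) (fun a => passK gens C a k) = true := h
          rwa [force_eq] at this
        obtain ⟨acc', C', a1, a2, a3, a4⟩ := ih hs' _ k (by
          intro j hj
          rcases bitB_xor hj with h3 | rfl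
          · exact ha j h3
          · exact hG) h'
        refine ⟨acc', C', a1, a2, fun c hc => by simp [a3 c hc], fun c hc => ?_⟩
        rw [List.mem_cons] at hc
        rcases hc with rfl | hc
        · exact Or.inr hG
        · exact a4 c hc
      | false =>
        rw [h2] at h
        obtain ⟨acc', C', a1, a2, a3, a4⟩ := ih hs' acc (fun a r => k a (m :: r)) ha h
        refine ⟨acc', m :: C', a1, a2, fun c hc => ?_, fun c hc => ?_⟩
        · rw [List.mem_cons] at hc ⊢
          exact hc.imp id (a3 c)
        · rw [List.mem_cons] at hc
          rcases hc with rfl | hc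
          · exact Or.inl (by simp)
          · exact (a4 c hc).imp (fun h => by simp [h]) id

theorem orbK_sound (Gd : ℕ → Prop) (gens : List (List (ℕ × ℕ))) (fuel : ℕ) :
    ∀ (acc : ℕ) (C : List ℕ) (k : List ℕ → Bool),
      (∀ c ∈ C, ∀ g ∈ gens, Gd (permM g c) → Gd c) → (∀ j, bitB acc j = true → Gd j) →
      orbK gens fuel acc C k = true → ∃ C', k C' = true ∧ ∀ c ∈ C, c ∈ C' ∨ Gd c := by
  induction fuel with
  | zero => intro acc C k _ _ h; exact ⟨C, h, fun c hc => Or.inl hc⟩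
  | succ n ih =>
    intro acc C k hs ha h
    have e : orbK gens (n + 1) acc C k = passK gens C acc (fun acc' C' =>
      Bool.rec (orbK gens n acc' C' k) (k C') (Nat.beq acc' acc)) := rfl
    rw [e] at h
    obtain ⟨acc', C', a1, a2, a3, a4⟩ := passK_sound Gd gens C hs acc _ ha h
    cases hb : Nat.beq acc' acc with
    | true =>
      simp only [hb] at a1
      exact ⟨C', a1, a4⟩
    | false =>
      simp only [hb] at a1
      obtain ⟨C'', b1, b2⟩ := ih acc' C' k (fun c hc => hs c (a3 c hc)) a2 a1
      refine ⟨C'', b1, fun c hc => ?_⟩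
      rcases a4 c hc with h1 | h1
      · exact b2 c h1
      · exact Or.inr h1

theorem andB_true {a b : Bool} (h : andB a b = true) : a = true ∧ b = true := by
  cases a <;> cases b <;> simp_all [andB]

theorem map_card_map (σ : Equiv.Perm (Fin 10)) (R : List (Finset (Fin 10))) :
    (R.map (fun s => s.map σ.toEmbedding)).map Finset.card = R.map Finset.card := by
  simp [List.map_map, Function.comp_def]

theorem check_sound (t : CTree) : ∀ (S C : List ℕ) (n : ℕ) (ps : List (ℕ × ℕ)),
    check t S C n ps = true → Inf S C n ps := by
  induction t with
  | leaf =>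
    intro S C n ps h
    have e : check .leaf S C n ps =
      cntK S 0 (fun cnt => filtI cnt C (fun l => dfs (runP ps) n cnt l)) := rfl
    rw [e, cntK_eq, Nat.zero_add] at h
    exact leaf_sound (runP_sound ps) h
  | orb r gens a b iha ihb =>
    have main : ∀ (S C : List ℕ) (n : ℕ) (ps : List (ℕ × ℕ)),
        cntK S 0 (fun cnt => filtM cnt C (fun C =>
          Nat.rec false (fun n' _ =>
            bitmapK C 0 (fun B =>
            andB (gensOK gens S C B)
            (andB (bitB B r)
            (andB (check a (r :: S) C n' ps)
              (orbK gens 12 (bitV r) C (fun C' => check b S C' (n' + 1) ps)))))) n)) = true →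
        Inf S C n ps := by
      intro S C n ps h
      rw [cntK_eq, Nat.zero_add, filtM_eq] at h
      apply Inf_of_filter
      generalize C.filter (fun m => okB (cntV S) (incV m)) = C0 at h
      cases n with
      | zero => exact absurd h (by simp)
      | succ n =>
        have h' : bitmapK C0 0 (fun B =>
            andB (gensOK gens S C0 B)
            (andB (bitB B r)
            (andB (check a (r :: S) C0 n ps)
              (orbK gens 12 (bitV r) C0 (fun C' => check b S C' (n + 1) ps))))) = true := h
        obtain ⟨B, hB, hBm⟩ := bitmapK_sound _ _ _ h'
        obtain ⟨h1, hB⟩ := andB_true hB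
        obtain ⟨_, hB⟩ := andB_true hB
        obtain ⟨h3, h4⟩ := andB_true hB
        have hC : ∀ j, bitB B j = true → j ∈ C0 := fun j hj =>
          (hBm j hj).resolve_left (bitB_zero j)
        have ha := iha _ _ _ _ h3
        obtain ⟨C', hC', hor⟩ := orbK_sound
          (fun c => ∀ T : List ℕ, T.length = n → (∀ t ∈ T, t ∈ C0) → Bad ps (c :: (T ++ S)))
          gens 12 (bitV r) C0 _ (by
            intro c _ g hg hG T hT hTm R hR h4
            unfold gensOK at h1
            rw [List.all_eq_true] at h1
            have hg1 := h1 g hg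
            simp only [Bool.and_eq_true, List.all_eq_true] at hg1
            obtain ⟨⟨g1, g2⟩, g3⟩ := hg1
            obtain ⟨σ, hσ⟩ := dec_permM g (by
              intro p hp
              have := g1 p hp
              simpa [Nat.blt] using this)
            have h5 := R4.map σ h4
            refine hG (T.map (permM g)) (by simpa using hT) ?_
              (R.map (fun s => s.map σ.toEmbedding)) (by rw [map_card_map]; exact hR) ?_
            · intro t ht
              obtain ⟨t', ht', rfl⟩ := List.mem_map.mp ht
              exact hC _ (g3 t' (hTm t' ht'))
            · refine R4.perm ?_ h5
              have hSp : (S.map (permM g)).Perm S := List.isPerm_iff.mp g2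
              have e2 : List.map (fun s => s.map σ.toEmbedding)
                  (List.map dec (c :: (T ++ S)) ++ R) =
                  List.map dec (permM g c :: (T.map (permM g) ++ S.map (permM g)))
                    ++ R.map (fun s => s.map σ.toEmbedding) := by
                simp [List.map_map, Function.comp_def, hσ]
              rw [e2]
              apply List.Perm.append_right
              apply List.Perm.map
              apply List.Perm.cons
              exact hSp.append_left _)
          (by
            intro j hj
            have e0 : bitV r = Nat.xor 0 (bitV r) := by
              have : Nat.xor 0 (bitV r) = 0 ^^^ bitV r := rfl
              rw [this, Nat.zero_xor]
            rw [e0] at hj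
            rcases bitB_xor hj with h5 | rfl
            · exact absurd h5 (bitB_zero j)
            · intro T hT hTm
              exact (ha T hT hTm).perm List.perm_middle) h4
        have hb := ihb _ _ _ _ hC'
        intro T hT hTm
        by_cases hall : ∀ t ∈ T, t ∈ C'
        · exact hb T hT hall
        · push Not at hall
          obtain ⟨t, ht, hno⟩ := hall
          have hG := (hor t (hTm t ht)).resolve_left hno
          have hp := List.perm_cons_erase ht
          have hl := hp.length_eq
          simp only [List.length_cons] at hl
          refine (hG (T.erase t) (by omega)
            (fun t' ht' => hTm t' (List.mem_of_mem_erase ht'))).perm ?_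
          exact hp.symm.append_right S
    intro S C n ps h
    cases n with
    | zero =>
      cases ps with
      | nil => exact absurd h (by simp [check, advance])
      | cons p ps =>
        have hI := main S (masksOf p.1) p.2 ps h
        intro T hT _
        rw [List.length_eq_zero_iff] at hT
        subst hT
        exact Bad_cons_of_Inf hI
    | succ n => exact main S C (n + 1) ps h

set_option maxRecDepth 100000 in
theorem crt_u : check (.orb 7 [[(1,3)],[(1,4)],[(1,5)],[(1,6)],[(1,7)],[(1,8)],[(1,9)],[(2,3)]] (.orb 25 [[(3,5)],[(3,6)],[(3,7)],[(3,8)],[(3,9)],[(4,5)]] (.orb 35 [[(1,2)],[(5,6)],[(5,7)],[(5,8)],[(5,9)],[(1,3),(2,4)]] (.orb 69 [[(2,5)],[(6,7)],[(6,8)],[(6,9)]] (.orb 137 [[(3,4)],[(7,8)],[(7,9)]] (.orb 274 [[(4,7)],[(8,9)],[(1,2),(5,6)]] .leaf (.orb 304 [[(4,7)],[(8,9)],[(1,2),(5,6)]] .leaf .leaf)) (.orb 385 [[(7,9)],[(8,9)]] (.orb 138 [[(3,4)],[(7,8)],[(1,2),(5,6)]] .leaf (.orb 522 [[(3,4)],[(3,7),(4,8)],[(1,2),(5,6)]]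 .leaf .leaf)) .leaf)) (.orb 73 [[(3,4)],[(6,7)],[(6,8)],[(6,9)]] (.orb 145 [[(4,6)],[(7,8)],[(7,9)]] (.orb 268 [[(2,5)],[(8,9)],[(3,4),(6,7)]] .leaf (.orb 324 [[(2,5)],[(8,9)],[(3,4),(6,7)]] .leaf .leaf)) (.orb 131 [[(7,8)],[(7,9)],[(1,3),(2,4),(5,6)]] (.orb 276 [[(2,5)],[(2,7)],[(4,6)],[(8,9)]] .leaf .leaf) (.orb 385 [[(7,9)],[(8,9)]] (.orb 146 [[(4,6)],[(7,8)],[(1,3),(2,4),(5,6)]] (.orb 517 [[(2,5)]] .leaf (.orb 518 [[(2,5)]] .leaf (.orb 268 [[(2,5)]] .leaf (.orb 524 [[(2,5)]] .leaf .leaf)))) (.orb 148 [[(2,5)],[(4,6)],[(7,8)]] (.orb 515 [[(1,3),(2,4),(5,6)]] .leaf (.orb 517 [[(1,3),(2,4),(5,6)]] .leaf (.orb 545 [[(1,3),(2,4),(5,6)]] .leaf (.orb 518 [[(1,3),(2,4),(5,6)]] .leaf (.orb 530 [[(1,3),(2,4),(5,6)]] .leaf .leaf))))) .leaf)) .leaf)))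 (.orb 193 [[(6,8)],[(6,9)],[(7,8)]] (.orb 321 [[(6,7)],[(8,9)]] (.orb 138 [[(3,4)],[(7,8)],[(1,6),(2,7),(5,8)]] (.orb 517 [[(2,5)]] .leaf (.orb 518 [[(2,5)]] .leaf (.orb 268 [[(2,5)]] .leaf (.orb 524 [[(2,5)]] .leaf .leaf)))) (.orb 140 [[(2,5)],[(3,4)],[(7,8)]] (.orb 515 [[(1,6),(2,7),(5,8)]] .leaf (.orb 517 [[(1,6),(2,7),(5,8)]] .leaf (.orb 545 [[(1,6),(2,7),(5,8)]] .leaf (.orb 518 [[(1,6),(2,7),(5,8)]] .leaf (.orb 522 [[(1,6),(2,7),(5,8)]] .leaf .leaf))))) .leaf)) (.orb 259 [[(8,9)]] (.orb 76 [[(2,5)],[(2,8)],[(3,4)],[(6,7)]] (.orb 168 [[(5,8)],[(3,6),(4,7)]] .leaf .leaf) (.orb 524 [[(2,5)],[(2,8)],[(3,4)],[(3,6),(4,7)]] .leaf .leaf)) (.orb 769 [] (.orb 76 [[(2,5)],[(6,7)],[(6,8),(7,9)],[(3,6),(4,7)]] (.orb 265 [[(8,9)],[(3,6),(4,7)]]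 .leaf (.orb 273 [[(8,9)],[(3,6),(4,7)]] .leaf (.orb 266 [[(8,9)],[(3,6),(4,7)]] .leaf (.orb 274 [[(8,9)],[(3,6),(4,7)]] .leaf (.orb 268 [[(8,9)],[(3,6),(4,7)]] .leaf (.orb 276 [[(8,9)],[(3,6),(4,7)]] .leaf .leaf)))))) .leaf) .leaf))) .leaf))) (.orb 97 [[(5,7)],[(5,8)],[(5,9)],[(6,7)]] (.orb 161 [[(5,6)],[(7,8)],[(7,9)]] (.orb 11 [[(1,2)],[(3,4)]] (.orb 322 [[(6,7)],[(8,9)],[(1,3),(2,4)]] .leaf (.orb 324 [[(6,7)],[(8,9)],[(1,3),(2,4)]] .leaf .leaf)) (.orb 321 [[(6,7)],[(8,9)]] (.orb 42 [[(1,2)],[(3,4)],[(5,6),(7,8)]] (.orb 515 [[(1,3),(2,4)]] .leaf .leaf) (.orb 138 [[(1,2)],[(3,4)],[(5,6),(7,8)]] .leaf .leaf)) (.orb 289 [[(8,9)]] (.orb 74 [[(1,2)],[(3,4)],[(6,7)],[(6,8)]] (.orb 146 [[(7,8)],[(1,3),(2,4)]] .leaf .leaf) (.orb 578 [[(1,2)],[(6,7)],[(6,8)],[(1,3),(2,4)]]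 .leaf .leaf)) (.orb 769 [] (.orb 74 [[(3,4)],[(6,7)],[(3,8),(4,9)],[(1,3),(2,4)]] (.orb 259 [[(8,9)],[(1,3),(2,4)]] .leaf (.orb 261 [[(8,9)],[(1,3),(2,4)]] .leaf (.orb 262 [[(8,9)],[(1,3),(2,4)]] .leaf (.orb 274 [[(8,9)],[(1,3),(2,4)]] .leaf (.orb 290 [[(8,9)],[(1,3),(2,4)]] .leaf (.orb 322 [[(8,9)],[(1,3),(2,4)]] .leaf (.orb 386 [[(8,9)],[(1,3),(2,4)]] .leaf .leaf))))))) .leaf) .leaf)))) (.orb 11 [[(1,2)],[(3,4)]] (.orb 385 [[(7,9)],[(8,9)]] (.orb 162 [[(5,6)],[(7,8)],[(1,3),(2,4)]] .leaf (.orb 546 [[(5,6)],[(5,7),(6,8)],[(1,3),(2,4)]] .leaf .leaf)) .leaf) (.orb 7 [[(3,5),(1,3),(4,6),(2,4)]] .leaf (.orb 385 [[(7,9)],[(8,9)]] (.orb 641 [[(7,8)]] (.orb 266 [[(3,4)],[(8,9)],[(3,5),(4,6)],[(1,3),(2,4)]] (.orb 35 [[(5,6)],[(1,3),(2,4)]]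 .leaf (.orb 37 [[(5,6)],[(1,3),(2,4)]] .leaf (.orb 38 [[(5,6)],[(1,3),(2,4)]] .leaf (.orb 50 [[(5,6)],[(1,3),(2,4)]] .leaf (.orb 162 [[(5,6)],[(1,3),(2,4)]] .leaf (.orb 290 [[(5,6)],[(1,3),(2,4)]] .leaf (.orb 546 [[(5,6)],[(1,3),(2,4)]] .leaf .leaf))))))) .leaf) .leaf) .leaf)))) .leaf)) .leaf) .leaf) [] (m3.filter (fun m => Nat.beq (Nat.mod m 2) 1)) 5 [(3,9)] = true := by decide +kernel

set_option maxRecDepth 100000 in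
theorem crt_a : check (.orb 3 [[(0,2)],[(0,3)],[(0,4)],[(0,5)],[(0,6)],[(0,7)],[(0,8)],[(0,9)],[(1,2)]] (.orb 13 [[(0,1)],[(2,4)],[(2,5)],[(2,6)],[(2,7)],[(2,8)],[(2,9)],[(3,4)]] (.orb 49 [[(4,6)],[(4,7)],[(4,8)],[(4,9)],[(5,6)]] (.orb 69 [[(2,3)],[(6,7)],[(6,8)],[(6,9)],[(2,4),(3,5)]] (.orb 145 [[(4,5)],[(7,8)],[(7,9)]] .leaf (.orb 146 [[(4,5)],[(7,8)],[(7,9)]] (.orb 769 [] .leaf (.orb 770 [] .leaf (.orb 280 [[(3,6)],[(8,9)]] .leaf .leaf))) (.orb 385 [[(7,9)],[(8,9)]] (.orb 641 [[(7,8)]] .leaf (.orb 642 [[(7,8)]] .leaf (.orb 152 [[(3,6)],[(4,5)],[(7,8)]] .leaf .leaf))) (.orb 386 [[(7,9)],[(8,9)]] (.orb 642 [[(7,8)]] .leaf (.orb 152 [[(3,6)],[(4,5)],[(7,8)]] .leaf .leaf)) (.orb 152 [[(3,6)],[(4,5)],[(7,8)],[(7,9)]] (.orb 276 [[(8,9)]]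 .leaf (.orb 292 [[(8,9)]] .leaf .leaf)) (.orb 148 [[(4,5)],[(7,8)],[(7,9)]] .leaf .leaf)))))) (.orb 70 [[(2,3)],[(6,7)],[(6,8)],[(6,9)],[(2,4),(3,5)]] (.orb 146 [[(4,5)],[(7,8)],[(7,9)]] (.orb 769 [[(0,1),(3,6),(5,7)]] .leaf (.orb 292 [[(8,9)],[(2,4),(3,5),(6,7)],[(0,1),(3,6),(5,7)]] .leaf .leaf)) (.orb 385 [[(7,9)],[(8,9)]] (.orb 641 [[(7,8)]] .leaf (.orb 642 [[(7,8)]] .leaf (.orb 148 [[(4,5)],[(7,8)]] .leaf (.orb 532 [[(4,5)],[(4,7),(5,8)]] .leaf .leaf)))) (.orb 386 [[(7,9)],[(8,9)]] (.orb 642 [[(7,8)]] .leaf (.orb 152 [[(7,8)],[(0,1),(3,6),(4,7),(5,8)]] .leaf .leaf)) (.orb 148 [[(4,5)],[(7,8)],[(7,9)]] (.orb 276 [[(8,9)]] .leaf (.orb 292 [[(8,9)]] .leaf (.orb 388 [[(8,9)]] .leaf (.orb 280 [[(8,9)]] .leaf (.orb 296 [[(8,9)]] .leaf .leaf))))) (.orb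 152 [[(4,5)],[(7,8)],[(7,9)]] (.orb 388 [[(8,9)]] .leaf .leaf) (.orb 208 [[(4,5)],[(7,8)],[(7,9)]] .leaf .leaf)))))) (.orb 193 [[(6,8)],[(6,9)],[(7,8)]] (.orb 321 [[(6,7)],[(8,9)]] (.orb 148 [[(2,3)],[(4,5)],[(7,8)]] .leaf .leaf) (.orb 322 [[(6,7)],[(8,9)]] (.orb 84 [[(2,3)],[(4,5)]] .leaf (.orb 148 [[(2,3)],[(4,5)]] .leaf .leaf)) (.orb 769 [] (.orb 84 [[(6,7)],[(6,8),(7,9)],[(4,6),(5,7)],[(2,4),(3,5)]] .leaf .leaf) (.orb 770 [] (.orb 276 [[(4,5)],[(8,9)],[(4,6),(5,7)],[(2,4),(3,5)]] .leaf .leaf) (.orb 276 [[(4,5)],[(8,9)],[(4,6),(5,7)],[(2,4),(3,5)]] (.orb 100 [[(6,7)],[(2,4),(3,5)]] .leaf (.orb 324 [[(6,7)],[(2,4),(3,5)]] .leaf (.orb 580 [[(6,7)],[(2,4),(3,5)]] .leaf .leaf))) .leaf))))) (.orb 194 [[(6,8)],[(6,9)],[(7,8)]] (.orb 322 [[(6,7)],[(8,9)]]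 (.orb 148 [[(2,3)],[(4,5)],[(7,8)]] .leaf .leaf) (.orb 770 [] (.orb 84 [[(6,7)],[(6,8),(7,9)],[(0,1),(2,6),(3,7),(4,8),(5,9)]] (.orb 292 [[(8,9)],[(2,4),(3,5)]] .leaf .leaf) .leaf) (.orb 324 [[(2,3)],[(6,7)],[(8,9)],[(2,4),(3,5)]] (.orb 84 [[(4,5)]] .leaf (.orb 148 [[(4,5)]] .leaf (.orb 276 [[(4,5)]] .leaf (.orb 532 [[(4,5)]] .leaf (.orb 88 [[(4,5)]] .leaf (.orb 152 [[(4,5)]] .leaf (.orb 280 [[(4,5)]] .leaf .leaf))))))) (.orb 84 [[(2,3)],[(4,5)],[(6,7)]] .leaf .leaf)))) (.orb 196 [[(2,3)],[(6,8)],[(6,9)],[(7,8)],[(2,4),(3,5)]] (.orb 336 [[(4,5)],[(6,7)],[(8,9)]] (.orb 268 [[(2,4),(3,5),(7,8)]] .leaf (.orb 524 [[(2,4),(3,5),(7,8)]] .leaf (.orb 148 [[(2,4),(3,5),(7,8)]] .leaf (.orb 100 [[(2,4),(3,5),(7,8)]] .leaf (.orb 164 [[(2,4),(3,5),(7,8)]]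 .leaf (.orb 292 [[(2,4),(3,5),(7,8)]] .leaf .leaf)))))) (.orb 84 [[(4,5)],[(6,7)]] .leaf (.orb 276 [[(4,5)],[(8,9)]] .leaf (.orb 324 [[(6,7)],[(8,9)]] .leaf (.orb 88 [[(4,5)],[(6,7)]] .leaf .leaf))))) (.orb 84 [[(2,3)],[(4,5)],[(6,7)],[(6,8)],[(6,9)]] .leaf .leaf)))))) (.orb 50 [[(4,6)],[(4,7)],[(4,8)],[(4,9)],[(5,6)]] (.orb 69 [[(2,3)],[(6,7)],[(6,8)],[(6,9)]] (.orb 146 [[(4,5)],[(7,8)],[(7,9)]] (.orb 770 [] .leaf (.orb 292 [[(5,7)],[(8,9)],[(0,1),(2,4),(3,5),(6,7)]] .leaf .leaf)) (.orb 386 [[(7,9)],[(8,9)]] (.orb 642 [[(7,8)]] .leaf (.orb 152 [[(3,6)],[(4,5)],[(7,8)]] .leaf .leaf)) (.orb 152 [[(3,6)],[(4,5)],[(7,8)],[(7,9)]] (.orb 276 [[(8,9)]] .leaf (.orb 292 [[(8,9)]] .leaf (.orb 388 [[(8,9)]] .leaf .leaf))) (.orb 148 [[(4,5)],[(7,8)],[(7,9)]]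 .leaf .leaf)))) (.orb 70 [[(2,3)],[(6,7)],[(6,8)],[(6,9)]] (.orb 146 [[(4,5)],[(7,8)],[(7,9)]] (.orb 770 [] .leaf (.orb 292 [[(5,7)],[(8,9)]] .leaf .leaf)) (.orb 386 [[(7,9)],[(8,9)]] (.orb 642 [[(7,8)]] .leaf (.orb 148 [[(4,5)],[(7,8)]] .leaf (.orb 532 [[(4,5)],[(4,7),(5,8)]] .leaf .leaf))) (.orb 148 [[(4,5)],[(7,8)],[(7,9)]] (.orb 276 [[(8,9)]] .leaf (.orb 292 [[(8,9)]] .leaf (.orb 388 [[(8,9)]] .leaf (.orb 280 [[(8,9)]] .leaf (.orb 296 [[(8,9)]] .leaf .leaf))))) (.orb 152 [[(4,5)],[(7,8)],[(7,9)]] (.orb 388 [[(8,9)]] .leaf .leaf) (.orb 208 [[(4,5)],[(7,8)],[(7,9)]] .leaf .leaf))))) (.orb 82 [[(4,5)],[(6,7)],[(6,8)],[(6,9)]] (.orb 386 [[(7,9)],[(8,9)]] (.orb 642 [[(7,8)]] .leaf (.orb 164 [[(2,3)],[(5,6)],[(7,8)]] .leaf .leaf)) (.orb 164 [[(2,3)],[(5,6)],[(7,8)],[(7,9)]]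 (.orb 268 [[(8,9)]] .leaf (.orb 276 [[(8,9)]] .leaf (.orb 292 [[(8,9)]] .leaf (.orb 324 [[(8,9)]] .leaf .leaf)))) (.orb 148 [[(2,3)],[(7,8)],[(7,9)]] .leaf .leaf))) (.orb 194 [[(6,8)],[(6,9)],[(7,8)]] (.orb 322 [[(6,7)],[(8,9)]] (.orb 148 [[(2,3)],[(4,5)],[(7,8)]] .leaf .leaf) (.orb 770 [] (.orb 84 [[(2,3)],[(6,7)],[(6,8),(7,9)],[(4,6),(5,7)]] .leaf .leaf) (.orb 276 [[(2,3)],[(4,5)],[(8,9)],[(4,6),(5,7)]] (.orb 84 [[(6,7)]] .leaf (.orb 100 [[(6,7)]] (.orb 515 [] .leaf (.orb 524 [] .leaf (.orb 532 [] .leaf (.orb 548 [] .leaf (.orb 580 [] .leaf (.orb 388 [] .leaf .leaf)))))) (.orb 324 [[(6,7)]] .leaf (.orb 580 [[(6,7)]] .leaf (.orb 88 [[(6,7)]] .leaf (.orb 104 [[(6,7)]] .leaf (.orb 328 [[(6,7)]] .leaf .leaf))))))) (.orb 84 [[(2,3)],[(4,5)],[(6,7)]] .leaf .leaf)))) (.orb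 196 [[(2,3)],[(6,8)],[(6,9)],[(7,8)],[(0,1),(2,4),(3,5)]] (.orb 336 [[(4,5)],[(6,7)],[(8,9)]] (.orb 268 [[(0,1),(2,4),(3,5),(7,8)]] .leaf (.orb 524 [[(0,1),(2,4),(3,5),(7,8)]] .leaf (.orb 148 [[(0,1),(2,4),(3,5),(7,8)]] .leaf (.orb 100 [[(0,1),(2,4),(3,5),(7,8)]] .leaf (.orb 164 [[(0,1),(2,4),(3,5),(7,8)]] .leaf (.orb 292 [[(0,1),(2,4),(3,5),(7,8)]] .leaf (.orb 548 [[(0,1),(2,4),(3,5),(7,8)]] .leaf .leaf))))))) (.orb 84 [[(4,5)],[(6,7)]] .leaf (.orb 276 [[(4,5)],[(8,9)]] (.orb 324 [[(6,7)]] .leaf (.orb 580 [[(6,7)]] .leaf .leaf)) (.orb 324 [[(6,7)],[(8,9)]] .leaf (.orb 88 [[(4,5)],[(6,7)]] .leaf .leaf))))) (.orb 84 [[(2,3)],[(4,5)],[(6,7)],[(6,8)],[(6,9)]] (.orb 140 [[(7,8)],[(7,9)],[(0,1),(2,4),(3,5)]] .leaf .leaf) .leaf)))))) (.orb 21 [[(2,3)],[(4,5)],[(4,6)],[(4,7)],[(4,8)],[(4,9)]]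 (.orb 104 [[(3,4)],[(5,7)],[(5,8)],[(5,9)],[(6,7)]] (.orb 164 [[(5,6)],[(7,8)],[(7,9)]] (.orb 292 [[(8,9)]] .leaf .leaf) (.orb 168 [[(5,6)],[(7,8)],[(7,9)]] .leaf (.orb 176 [[(5,6)],[(7,8)],[(7,9)]] .leaf .leaf))) .leaf) (.orb 22 [[(2,3)],[(4,5)],[(4,6)],[(4,7)],[(4,8)],[(4,9)]] (.orb 104 [[(5,7)],[(5,8)],[(5,9)],[(6,7)],[(0,1),(3,4)]] (.orb 164 [[(5,6)],[(7,8)],[(7,9)]] (.orb 292 [[(8,9)]] .leaf (.orb 324 [[(8,9)]] .leaf .leaf)) (.orb 168 [[(5,6)],[(7,8)],[(7,9)]] .leaf (.orb 176 [[(5,6)],[(7,8)],[(7,9)]] .leaf .leaf))) .leaf) (.orb 13 [] .leaf (.orb 14 [] .leaf (.orb 52 [[(2,3)],[(4,6)],[(4,7)],[(4,8)],[(4,9)],[(5,6)]] (.orb 208 [[(4,5)],[(6,8)],[(6,9)],[(7,8)]] (.orb 324 [[(6,7)],[(8,9)]] .leaf (.orb 328 [[(6,7)],[(8,9)]] .leaf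 (.orb 336 [[(6,7)],[(8,9)]] .leaf (.orb 352 [[(6,7)],[(8,9)]] .leaf (.orb 67 [[(6,7)]] .leaf (.orb 259 [[(8,9)]] .leaf (.orb 76 [[(6,7)]] .leaf .leaf))))))) (.orb 84 [[(4,5)],[(6,7)],[(6,8)],[(6,9)]] (.orb 131 [[(7,8)],[(7,9)]] .leaf (.orb 140 [[(7,8)],[(7,9)]] .leaf .leaf)) (.orb 88 [[(4,5)],[(6,7)],[(6,8)],[(6,9)]] (.orb 131 [[(7,8)],[(7,9)]] .leaf (.orb 140 [[(7,8)],[(7,9)]] .leaf .leaf)) (.orb 196 [[(6,8)],[(6,9)],[(7,8)]] .leaf .leaf)))) (.orb 112 [[(4,7)],[(4,8)],[(4,9)],[(5,7)],[(6,7)]] (.orb 176 [[(4,6)],[(5,6)],[(7,8)],[(7,9)]] .leaf .leaf) .leaf)))))))) (.orb 28 [[(2,5)],[(2,6)],[(2,7)],[(2,8)],[(2,9)],[(3,5)],[(4,5)]] (.orb 100 [[(2,3)],[(2,4)],[(5,7)],[(5,8)],[(5,9)],[(6,7)]] (.orb 140 [[(3,4)],[(7,8)],[(7,9)],[(3,5),(4,6)]]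 (.orb 304 [[(4,7)],[(5,6)],[(8,9)]] .leaf .leaf) (.orb 168 [[(3,4)],[(5,6)],[(7,8)],[(7,9)]] (.orb 280 [[(8,9)],[(3,5),(4,6)]] .leaf (.orb 328 [[(8,9)],[(3,5),(4,6)]] .leaf (.orb 392 [[(8,9)],[(3,5),(4,6)]] .leaf .leaf))) (.orb 392 [[(3,4)],[(7,9)],[(8,9)],[(3,5),(4,6)]] .leaf .leaf))) (.orb 44 [[(2,4)],[(3,4)],[(5,6)],[(5,7)],[(5,8)],[(5,9)]] .leaf .leaf)) .leaf)) .leaf) [] (masksOf 2) 1 [(3, 12), (4, 1)] = true := by decide +kernel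

set_option maxRecDepth 100000 in
theorem crt_b : check (.orb 1 [[(0,1)],[(0,2)],[(0,3)],[(0,4)],[(0,5)],[(0,6)],[(0,7)],[(0,8)],[(0,9)]] (.orb 7 [[(1,3)],[(1,4)],[(1,5)],[(1,6)],[(1,7)],[(1,8)],[(1,9)],[(2,3)]] (.orb 25 [[(3,5)],[(3,6)],[(3,7)],[(3,8)],[(3,9)],[(4,5)]] (.orb 97 [[(5,7)],[(5,8)],[(5,9)],[(6,7)]] .leaf (.orb 98 [[(1,2)],[(5,7)],[(5,8)],[(5,9)],[(6,7)],[(1,3),(2,4)]] .leaf .leaf)) (.orb 11 [[(1,2)],[(3,4)],[(3,5)],[(3,6)],[(3,7)],[(3,8)],[(3,9)]] .leaf (.orb 7 [] .leaf (.orb 26 [[(1,2)],[(3,5)],[(3,6)],[(3,7)],[(3,8)],[(3,9)],[(4,5)]] (.orb 104 [[(3,4)],[(5,7)],[(5,8)],[(5,9)],[(6,7)]] (.orb 162 [[(5,6)],[(7,8)],[(7,9)]] .leaf (.orb 164 [[(5,6)],[(7,8)],[(7,9)]] .leaf (.orb 168 [[(5,6)],[(7,8)],[(7,9)]] .leaf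 .leaf))) .leaf) (.orb 56 [[(3,6)],[(3,7)],[(3,8)],[(3,9)],[(4,6)],[(5,6)]] (.orb 200 [[(3,4)],[(3,5)],[(6,8)],[(6,9)],[(7,8)]] .leaf .leaf) .leaf))))) (.orb 14 [[(1,4)],[(1,5)],[(1,6)],[(1,7)],[(1,8)],[(1,9)],[(2,4)],[(3,4)]] (.orb 50 [[(1,2)],[(1,3)],[(4,6)],[(4,7)],[(4,8)],[(4,9)],[(5,6)]] (.orb 196 [[(2,3)],[(6,8)],[(6,9)],[(7,8)],[(2,4),(3,5)]] (.orb 82 [[(6,7)],[(1,2),(4,6),(5,7)]] (.orb 262 [[(8,9)]] .leaf (.orb 266 [[(8,9)]] .leaf (.orb 386 [[(8,9)]] .leaf (.orb 268 [[(8,9)]] .leaf (.orb 276 [[(8,9)]] .leaf (.orb 292 [[(8,9)]] .leaf .leaf)))))) (.orb 274 [[(4,5)],[(8,9)],[(1,2),(4,6),(5,7)]] (.orb 578 [[(6,7)]] .leaf .leaf) (.orb 322 [[(6,7)],[(8,9)],[(1,2),(4,6),(5,7)]] (.orb 276 [[(4,5)]] .leaf (.orb 532 [[(4,5)]] .leaf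 (.orb 88 [[(4,5)]] .leaf (.orb 152 [[(4,5)]] .leaf .leaf)))) (.orb 280 [[(4,5)],[(8,9)],[(1,2),(4,6),(5,7)]] (.orb 88 [[(6,7)]] .leaf (.orb 104 [[(6,7)]] .leaf .leaf)) (.orb 336 [[(4,5)],[(6,7)],[(8,9)]] .leaf .leaf))))) (.orb 70 [[(2,3)],[(6,7)],[(6,8)],[(6,9)],[(2,4),(3,5)]] (.orb 146 [[(4,5)],[(7,8)],[(7,9)]] .leaf .leaf) (.orb 84 [[(2,3)],[(4,5)],[(6,7)],[(6,8)],[(6,9)]] (.orb 140 [[(7,8)],[(7,9)],[(2,4),(3,5)]] .leaf .leaf) .leaf))) (.orb 112 [[(4,7)],[(4,8)],[(4,9)],[(5,7)],[(6,7)]] .leaf .leaf)) .leaf)) .leaf) [] (masksOf 1) 1 [(3, 11), (4, 2)] = true := by decide +kernel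

set_option maxRecDepth 100000 in
theorem crt_c : check (.orb 1 [[(0,1)],[(0,2)],[(0,3)],[(0,4)],[(0,5)],[(0,6)],[(0,7)],[(0,8)],[(0,9)]] (.orb 7 [[(1,3)],[(1,4)],[(1,5)],[(1,6)],[(1,7)],[(1,8)],[(1,9)],[(2,3)]] (.orb 25 [[(3,5)],[(3,6)],[(3,7)],[(3,8)],[(3,9)],[(4,5)]] (.orb 97 [[(5,7)],[(5,8)],[(5,9)],[(6,7)]] .leaf (.orb 98 [[(1,2)],[(5,7)],[(5,8)],[(5,9)],[(6,7)],[(1,3),(2,4)]] .leaf .leaf)) (.orb 11 [[(1,2)],[(3,4)],[(3,5)],[(3,6)],[(3,7)],[(3,8)],[(3,9)]] .leaf (.orb 7 [] .leaf (.orb 26 [[(1,2)],[(3,5)],[(3,6)],[(3,7)],[(3,8)],[(3,9)],[(4,5)]] (.orb 104 [[(3,4)],[(5,7)],[(5,8)],[(5,9)],[(6,7)]] (.orb 162 [[(5,6)],[(7,8)],[(7,9)]] .leaf (.orb 164 [[(5,6)],[(7,8)],[(7,9)]] .leaf (.orb 168 [[(5,6)],[(7,8)],[(7,9)]] .leaf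 .leaf))) .leaf) (.orb 56 [[(3,6)],[(3,7)],[(3,8)],[(3,9)],[(4,6)],[(5,6)]] (.orb 200 [[(3,4)],[(3,5)],[(6,8)],[(6,9)],[(7,8)]] .leaf .leaf) .leaf))))) (.orb 14 [[(1,4)],[(1,5)],[(1,6)],[(1,7)],[(1,8)],[(1,9)],[(2,4)],[(3,4)]] (.orb 50 [[(1,2)],[(1,3)],[(4,6)],[(4,7)],[(4,8)],[(4,9)],[(5,6)]] (.orb 196 [[(2,3)],[(6,8)],[(6,9)],[(7,8)],[(2,4),(3,5)]] (.orb 82 [[(6,7)],[(1,2),(4,6),(5,7)]] (.orb 262 [[(8,9)]] .leaf (.orb 266 [[(8,9)]] .leaf (.orb 386 [[(8,9)]] .leaf (.orb 268 [[(8,9)]] .leaf (.orb 276 [[(8,9)]] .leaf (.orb 292 [[(8,9)]] .leaf .leaf)))))) (.orb 274 [[(4,5)],[(8,9)],[(1,2),(4,6),(5,7)]] (.orb 578 [[(6,7)]] .leaf .leaf) (.orb 322 [[(6,7)],[(8,9)],[(1,2),(4,6),(5,7)]] (.orb 276 [[(4,5)]] .leaf (.orb 532 [[(4,5)]] .leaf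 (.orb 88 [[(4,5)]] .leaf (.orb 152 [[(4,5)]] .leaf .leaf)))) (.orb 280 [[(4,5)],[(8,9)],[(1,2),(4,6),(5,7)]] (.orb 88 [[(6,7)]] .leaf (.orb 104 [[(6,7)]] .leaf .leaf)) (.orb 336 [[(4,5)],[(6,7)],[(8,9)]] .leaf .leaf))))) (.orb 70 [[(2,3)],[(6,7)],[(6,8)],[(6,9)],[(2,4),(3,5)]] (.orb 146 [[(4,5)],[(7,8)],[(7,9)]] .leaf .leaf) (.orb 84 [[(2,3)],[(4,5)],[(6,7)],[(6,8)],[(6,9)]] (.orb 140 [[(7,8)],[(7,9)],[(2,4),(3,5)]] .leaf .leaf) .leaf))) (.orb 112 [[(4,7)],[(4,8)],[(4,9)],[(5,7)],[(6,7)]] .leaf .leaf)) .leaf)) .leaf) [] (masksOf 1) 1 [(3, 12), (5, 1)] = true := by decide +kernel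

set_option maxRecDepth 100000 in
theorem crt_d : check (.orb 3 [[(0,2)],[(0,3)],[(0,4)],[(0,5)],[(0,6)],[(0,7)],[(0,8)],[(0,9)],[(1,2)]] (.orb 12 [[(2,4)],[(2,5)],[(2,6)],[(2,7)],[(2,8)],[(2,9)],[(3,4)]] (.orb 49 [[(0,1)],[(4,6)],[(4,7)],[(4,8)],[(4,9)],[(5,6)],[(0,2),(1,3)]] (.orb 84 [[(2,3)],[(4,5)],[(6,7)],[(6,8)],[(6,9)]] (.orb 131 [[(7,8)],[(7,9)],[(0,2),(1,3),(5,6)]] .leaf (.orb 137 [[(7,8)],[(7,9)],[(0,2),(1,3),(5,6)]] (.orb 273 [[(8,9)]] .leaf (.orb 289 [[(8,9)]] .leaf (.orb 321 [[(8,9)]] .leaf (.orb 274 [[(8,9)]] .leaf (.orb 290 [[(8,9)]] .leaf (.orb 322 [[(8,9)]] .leaf .leaf)))))) (.orb 145 [[(7,8)],[(7,9)],[(0,2),(1,3),(5,6)]] (.orb 292 [[(5,7)],[(8,9)]] .leaf .leaf) (.orb 161 [[(7,8)],[(7,9)],[(0,2),(1,3),(5,6)]] (.orb 261 [[(8,9)]]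 .leaf (.orb 321 [[(8,9)]] .leaf .leaf)) (.orb 193 [[(7,8)],[(7,9)],[(0,2),(1,3),(5,6)]] (.orb 261 [[(8,9)]] .leaf (.orb 321 [[(8,9)]] .leaf (.orb 385 [[(8,9)]] .leaf (.orb 274 [[(8,9)],[(4,6),(5,7)]] .leaf (.orb 290 [[(8,9)],[(4,6),(5,7)]] .leaf (.orb 292 [[(8,9)],[(4,6),(5,7)]] .leaf .leaf)))))) (.orb 385 [[(7,9)],[(8,9)],[(0,2),(1,3),(5,6)]] .leaf (.orb 146 [[(7,8)],[(7,9)],[(0,2),(1,3),(5,6)]] .leaf (.orb 162 [[(7,8)],[(7,9)],[(0,2),(1,3),(5,6)]] .leaf (.orb 194 [[(7,8)],[(7,9)],[(0,2),(1,3),(5,6)]] .leaf (.orb 386 [[(7,9)],[(8,9)],[(0,2),(1,3),(5,6)]] .leaf .leaf)))))))))) (.orb 196 [[(2,3)],[(6,8)],[(6,9)],[(7,8)]] (.orb 336 [[(4,5)],[(6,7)],[(8,9)]] (.orb 515 [] .leaf (.orb 261 [] .leaf .leaf)) (.orb 81 [[(4,5)],[(6,7)]] .leaf (.orb 273 [[(4,5)],[(8,9)]]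 .leaf (.orb 321 [[(6,7)],[(8,9)]] .leaf (.orb 82 [[(4,5)],[(6,7)]] .leaf .leaf))))) (.orb 208 [[(4,5)],[(6,8)],[(6,9)],[(7,8)]] (.orb 69 [[(2,3)],[(6,7)]] .leaf (.orb 261 [[(2,3)],[(8,9)]] .leaf (.orb 321 [[(6,7)],[(8,9)]] .leaf (.orb 70 [[(2,3)],[(6,7)]] .leaf .leaf)))) (.orb 69 [[(2,3)],[(6,7)],[(6,8)],[(6,9)]] .leaf (.orb 81 [[(4,5)],[(6,7)],[(6,8)],[(6,9)]] .leaf (.orb 70 [[(2,3)],[(6,7)],[(6,8)],[(6,9)]] .leaf .leaf)))))) (.orb 21 [[(0,1)],[(2,3)],[(4,5)],[(4,6)],[(4,7)],[(4,8)],[(4,9)]] .leaf (.orb 112 [[(4,7)],[(4,8)],[(4,9)],[(5,7)],[(6,7)]] (.orb 176 [[(4,6)],[(5,6)],[(7,8)],[(7,9)]] .leaf .leaf) .leaf))) (.orb 5 [[(0,1)],[(2,3)],[(2,4)],[(2,5)],[(2,6)],[(2,7)],[(2,8)],[(2,9)]] (.orb 26 [[(1,2)],[(3,5)],[(3,6)],[(3,7)],[(3,8)],[(3,9)],[(4,5)]]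 (.orb 104 [[(3,4)],[(5,7)],[(5,8)],[(5,9)],[(6,7)]] (.orb 161 [[(5,6)],[(7,8)],[(7,9)]] .leaf (.orb 162 [[(5,6)],[(7,8)],[(7,9)]] .leaf (.orb 164 [[(5,6)],[(7,8)],[(7,9)]] .leaf (.orb 168 [[(5,6)],[(7,8)],[(7,9)]] .leaf (.orb 176 [[(5,6)],[(7,8)],[(7,9)]] .leaf .leaf))))) .leaf) (.orb 56 [[(3,6)],[(3,7)],[(3,8)],[(3,9)],[(4,6)],[(5,6)]] (.orb 200 [[(3,4)],[(3,5)],[(6,8)],[(6,9)],[(7,8)]] (.orb 273 [[(4,5)],[(8,9)],[(4,6),(5,7)]] .leaf (.orb 280 [[(4,5)],[(8,9)],[(4,6),(5,7)]] .leaf .leaf)) (.orb 73 [[(3,4)],[(3,5)],[(6,7)],[(6,8)],[(6,9)]] .leaf .leaf)) .leaf)) (.orb 3 [] (.orb 13 [[(0,1)],[(2,4)],[(2,5)],[(2,6)],[(2,7)],[(2,8)],[(2,9)],[(3,4)]] .leaf (.orb 28 [[(2,5)],[(2,6)],[(2,7)],[(2,8)],[(2,9)],[(3,5)],[(4,5)]]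 (.orb 100 [[(2,3)],[(2,4)],[(5,7)],[(5,8)],[(5,9)],[(6,7)]] .leaf .leaf) .leaf)) .leaf))) .leaf) [] (masksOf 2) 2 [(3, 10)] = true := by decide +kernel

set_option maxRecDepth 100000 in
theorem crt_e : check (.orb 3 [[(0,2)],[(0,3)],[(0,4)],[(0,5)],[(0,6)],[(0,7)],[(0,8)],[(0,9)],[(1,2)]] (.orb 12 [[(2,4)],[(2,5)],[(2,6)],[(2,7)],[(2,8)],[(2,9)],[(3,4)]] (.orb 17 [[(0,1)],[(4,5)],[(4,6)],[(4,7)],[(4,8)],[(4,9)],[(0,2),(1,3)]] (.orb 98 [[(1,4)],[(5,7)],[(5,8)],[(5,9)],[(6,7)]] (.orb 164 [[(2,3)],[(5,6)],[(7,8)],[(7,9)]] .leaf .leaf) (.orb 97 [[(5,7)],[(5,8)],[(5,9)],[(6,7)]] .leaf (.orb 100 [[(2,3)],[(5,7)],[(5,8)],[(5,9)],[(6,7)]] .leaf .leaf))) (.orb 48 [[(4,6)],[(4,7)],[(4,8)],[(4,9)],[(5,6)]] (.orb 69 [[(2,3)],[(6,7)],[(6,8)],[(6,9)],[(2,4),(3,5)],[(0,2),(1,3)]]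 (.orb 145 [[(4,5)],[(7,8)],[(7,9)],[(0,2),(1,3)]] .leaf (.orb 146 [[(4,5)],[(7,8)],[(7,9)],[(0,2),(1,3)]] .leaf .leaf)) (.orb 193 [[(0,1)],[(6,8)],[(6,9)],[(7,8)],[(2,4),(0,2),(3,5),(1,3)]] .leaf .leaf)) (.orb 5 [[(0,1)],[(2,3)]] .leaf .leaf))) (.orb 5 [[(0,1)],[(2,3)],[(2,4)],[(2,5)],[(2,6)],[(2,7)],[(2,8)],[(2,9)]] (.orb 9 [[(3,4)],[(3,5)],[(3,6)],[(3,7)],[(3,8)],[(3,9)]] .leaf (.orb 10 [[(3,4)],[(3,5)],[(3,6)],[(3,7)],[(3,8)],[(3,9)]] .leaf .leaf)) .leaf)) .leaf) [] (masksOf 2) 3 [(3, 8)] = true := by decide +kernel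

set_option maxRecDepth 100000 in
theorem crt_f : check (.orb 3 [[(0,2)],[(0,3)],[(0,4)],[(0,5)],[(0,6)],[(0,7)],[(0,8)],[(0,9)],[(1,2)]] (.orb 12 [[(2,4)],[(2,5)],[(2,6)],[(2,7)],[(2,8)],[(2,9)],[(3,4)]] (.orb 17 [[(0,1)],[(4,5)],[(4,6)],[(4,7)],[(4,8)],[(4,9)],[(0,2),(1,3)]] (.orb 96 [[(5,7)],[(5,8)],[(5,9)],[(6,7)]] .leaf .leaf) (.orb 48 [[(4,6)],[(4,7)],[(4,8)],[(4,9)],[(5,6)]] (.orb 80 [[(4,5)],[(6,7)],[(6,8)],[(6,9)]] .leaf (.orb 192 [[(6,8)],[(6,9)],[(7,8)]] (.orb 261 [[(2,3)],[(8,9)],[(4,6),(2,4),(5,7),(3,5)],[(0,2),(1,3)]] .leaf .leaf) .leaf)) .leaf)) .leaf) .leaf) [] (masksOf 2) 4 [(3, 6)] = true := by decide +kernel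

set_option maxRecDepth 100000 in
theorem crt_g : check (.orb 3 [[(0,2)],[(0,3)],[(0,4)],[(0,5)],[(0,6)],[(0,7)],[(0,8)],[(0,9)],[(1,2)]] (.orb 12 [[(2,4)],[(2,5)],[(2,6)],[(2,7)],[(2,8)],[(2,9)],[(3,4)]] (.orb 17 [[(0,1)],[(4,5)],[(4,6)],[(4,7)],[(4,8)],[(4,9)],[(0,2),(1,3)]] .leaf (.orb 48 [[(4,6)],[(4,7)],[(4,8)],[(4,9)],[(5,6)]] .leaf .leaf)) .leaf) .leaf) [] (masksOf 2) 5 [(3, 4)] = true := by decide +kernel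

set_option maxRecDepth 100000 in
theorem crt_h : check (.orb 3 [[(0,2)],[(0,3)],[(0,4)],[(0,5)],[(0,6)],[(0,7)],[(0,8)],[(0,9)],[(1,2)]] (.orb 5 [[(0,1)],[(2,3)],[(2,4)],[(2,5)],[(2,6)],[(2,7)],[(2,8)],[(2,9)]] .leaf (.orb 12 [[(2,4)],[(2,5)],[(2,6)],[(2,7)],[(2,8)],[(2,9)],[(3,4)]] .leaf .leaf)) .leaf) [] (masksOf 2) 6 [] = true := by decide +kernel

set_option maxRecDepth 100000 in
theorem crt_i : check (.orb 1 [[(0,1)],[(0,2)],[(0,3)],[(0,4)],[(0,5)],[(0,6)],[(0,7)],[(0,8)],[(0,9)]] (.orb 2 [[(1,2)],[(1,3)],[(1,4)],[(1,5)],[(1,6)],[(1,7)],[(1,8)],[(1,9)]] (.orb 13 [[(0,1)],[(2,4)],[(2,5)],[(2,6)],[(2,7)],[(2,8)],[(2,9)],[(3,4)]] .leaf (.orb 28 [[(2,5)],[(2,6)],[(2,7)],[(2,8)],[(2,9)],[(3,5)],[(4,5)]] (.orb 100 [[(2,3)],[(2,4)],[(5,7)],[(5,8)],[(5,9)],[(6,7)]]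 (.orb 392 [[(3,4)],[(7,9)],[(8,9)],[(3,5),(4,6)]] .leaf .leaf) .leaf) .leaf)) (.orb 1 [] (.orb 14 [[(1,4)],[(1,5)],[(1,6)],[(1,7)],[(1,8)],[(1,9)],[(2,4)],[(3,4)]] .leaf .leaf) .leaf)) .leaf) [] (masksOf 1) 2 [(3, 8), (4, 1)] = true := by decide +kernel

set_option maxRecDepth 100000 in
theorem crt_j : check (.orb 1 [[(0,1)],[(0,2)],[(0,3)],[(0,4)],[(0,5)],[(0,6)],[(0,7)],[(0,8)],[(0,9)]] (.orb 6 [[(1,3)],[(1,4)],[(1,5)],[(1,6)],[(1,7)],[(1,8)],[(1,9)],[(2,3)]] (.orb 26 [[(1,2)],[(3,5)],[(3,6)],[(3,7)],[(3,8)],[(3,9)],[(4,5)]] (.orb 104 [[(3,4)],[(5,7)],[(5,8)],[(5,9)],[(6,7)]] (.orb 161 [[(5,6)],[(7,8)],[(7,9)]] .leaf (.orb 162 [[(5,6)],[(7,8)],[(7,9)]] .leaf (.orb 164 [[(5,6)],[(7,8)],[(7,9)]] .leaf (.orb 168 [[(5,6)],[(7,8)],[(7,9)]] .leaf (.orb 176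 [[(5,6)],[(7,8)],[(7,9)]] .leaf .leaf))))) .leaf) (.orb 56 [[(3,6)],[(3,7)],[(3,8)],[(3,9)],[(4,6)],[(5,6)]] (.orb 200 [[(3,4)],[(3,5)],[(6,8)],[(6,9)],[(7,8)]] .leaf .leaf) .leaf)) (.orb 3 [[(1,2)],[(1,3)],[(1,4)],[(1,5)],[(1,6)],[(1,7)],[(1,8)],[(1,9)]] (.orb 28 [[(2,5)],[(2,6)],[(2,7)],[(2,8)],[(2,9)],[(3,5)],[(4,5)]] (.orb 100 [[(2,3)],[(2,4)],[(5,7)],[(5,8)],[(5,9)],[(6,7)]] .leaf .leaf) .leaf) .leaf)) .leaf) [] (masksOf 1) 1 [(2, 1), (3, 9)] = true := by decide +kernel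

set_option maxRecDepth 100000 in
theorem crt_k : check (.orb 1 [[(0,1)],[(0,2)],[(0,3)],[(0,4)],[(0,5)],[(0,6)],[(0,7)],[(0,8)],[(0,9)]] (.orb 6 [[(1,3)],[(1,4)],[(1,5)],[(1,6)],[(1,7)],[(1,8)],[(1,9)],[(2,3)]] (.orb 24 [[(3,5)],[(3,6)],[(3,7)],[(3,8)],[(3,9)],[(4,5)]] (.orb 98 [[(1,2)],[(5,7)],[(5,8)],[(5,9)],[(6,7)],[(1,3),(2,4)]] .leaf .leaf) (.orb 10 [[(1,2)],[(3,4)],[(3,5)],[(3,6)],[(3,7)],[(3,8)],[(3,9)]] .leaf .leaf)) .leaf) .leaf) [] (masksOf 1) 1 [(2, 2), (3, 7)] = true := by decide +kernel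

set_option maxRecDepth 100000 in
theorem crt_l : check (.orb 1 [[(0,1)],[(0,2)],[(0,3)],[(0,4)],[(0,5)],[(0,6)],[(0,7)],[(0,8)],[(0,9)]] (.orb 6 [[(1,3)],[(1,4)],[(1,5)],[(1,6)],[(1,7)],[(1,8)],[(1,9)],[(2,3)]] (.orb 24 [[(3,5)],[(3,6)],[(3,7)],[(3,8)],[(3,9)],[(4,5)]] .leaf .leaf) .leaf) .leaf) [] (masksOf 1) 1 [(2, 3), (3, 5)] = true := by decide +kernel

set_option maxRecDepth 100000 in
theorem crt_m : check (.orb 1 [[(0,1)],[(0,2)],[(0,3)],[(0,4)],[(0,5)],[(0,6)],[(0,7)],[(0,8)],[(0,9)]] (.orb 6 [[(1,3)],[(1,4)],[(1,5)],[(1,6)],[(1,7)],[(1,8)],[(1,9)],[(2,3)]] (.orb 24 [[(3,5)],[(3,6)],[(3,7)],[(3,8)],[(3,9)],[(4,5)]] .leaf .leaf) .leaf) .leaf) [] (masksOf 1) 1 [(2, 4), (3, 3)] = true := by decide +kernel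

set_option maxRecDepth 100000 in
theorem crt_n : check (.orb 1 [[(0,1)],[(0,2)],[(0,3)],[(0,4)],[(0,5)],[(0,6)],[(0,7)],[(0,8)],[(0,9)]] (.orb 2 [[(1,2)],[(1,3)],[(1,4)],[(1,5)],[(1,6)],[(1,7)],[(1,8)],[(1,9)]] (.orb 12 [[(2,4)],[(2,5)],[(2,6)],[(2,7)],[(2,8)],[(2,9)],[(3,4)]] .leaf .leaf) .leaf) .leaf) [] (masksOf 1) 2 [(2, 1), (3, 4)] = true := by decide +kernel

set_option maxRecDepth 100000 in
theorem crt_o : check (.orb 1 [[(0,1)],[(0,2)],[(0,3)],[(0,4)],[(0,5)],[(0,6)],[(0,7)],[(0,8)],[(0,9)]] (.orb 2 [[(1,2)],[(1,3)],[(1,4)],[(1,5)],[(1,6)],[(1,7)],[(1,8)],[(1,9)]] .leaf .leaf) .leaf) [] (masksOf 1) 2 [(2, 2)] = true := by decide +kernel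

set_option maxRecDepth 100000 in
theorem crt_p : check (.orb 1 [[(0,1)],[(0,2)],[(0,3)],[(0,4)],[(0,5)],[(0,6)],[(0,7)],[(0,8)],[(0,9)]] .leaf .leaf) [] (masksOf 1) 3 [(3, 1)] = true := by decide +kernel

set_option maxRecDepth 100000 in
theorem crt_q : check (.orb 0 [] (.orb 7 [[(0,3)],[(0,4)],[(0,5)],[(0,6)],[(0,7)],[(0,8)],[(0,9)],[(1,3)],[(2,3)]] (.orb 25 [[(0,1)],[(0,2)],[(3,5)],[(3,6)],[(3,7)],[(3,8)],[(3,9)],[(4,5)]] (.orb 98 [[(1,2)],[(5,7)],[(5,8)],[(5,9)],[(6,7)],[(1,3),(2,4)]] .leaf .leaf) (.orb 11 [[(0,2)],[(1,2)],[(3,4)],[(3,5)],[(3,6)],[(3,7)],[(3,8)],[(3,9)]] .leaf (.orb 56 [[(3,6)],[(3,7)],[(3,8)],[(3,9)],[(4,6)],[(5,6)]] .leaf .leaf))) .leaf) .leaf) [] (masksOf 0) 1 [(3, 7)] = true := by decide +kernel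

set_option maxRecDepth 100000 in
theorem crt_r : check (.orb 0 [] (.orb 3 [[(0,2)],[(0,3)],[(0,4)],[(0,5)],[(0,6)],[(0,7)],[(0,8)],[(0,9)],[(1,2)]] .leaf .leaf) .leaf) [] (masksOf 0) 1 [(2, 3)] = true := by decide +kernel


/-! ### The first inequality -/

theorem part_one (G : Finset (Fin 10 × Fin 14)) (hG : ¬ ContainsK 10 14 2 2 G) :
    G.card ≤ 42 := by
  by_contra hcard
  push Not at hcard
  let B : Fin 14 → Finset (Fin 10) := fun y => Finset.univ.filter (fun x => (x, y) ∈ G)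
  have hB : ∀ x y, x ∈ B y ↔ (x, y) ∈ G := by intro x y; simp [B]
  have hsum : ∑ y, (B y).card = G.card := by
    rw [Finset.card_eq_sum_card_fiberwise (f := Prod.snd) (t := Finset.univ) (by simp)]
    apply Finset.sum_congr rfl
    intro y _
    apply Finset.card_bij (fun x _ => (x, y))
    · intro x hx; simpa [hB] using hx
    · intro a _ b _ h; simpa using h
    · rintro ⟨x, y'⟩ h
      simp only [Finset.mem_filter] at h
      obtain ⟨h1, rfl⟩ := h
      exact ⟨x, (hB _ _).mpr h1, rfl⟩
  have hno : ∀ a b y z, a ≠ b → y ≠ z → a ∈ B y → b ∈ B y → a ∈ B z → b ∈ B z → False := by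
    intro a b y z hab hyz h1 h2 h3 h4
    rw [hB] at h1 h2 h3 h4
    apply hG
    refine ⟨{a, b}, {y, z}, Finset.card_pair hab, Finset.card_pair hyz, ?_⟩
    intro u hu v hv
    simp only [Finset.mem_insert, Finset.mem_singleton] at hu hv
    rcases hu with rfl | rfl <;> rcases hv with rfl | rfl <;> assumption
  have hdis : ∀ y ∈ (Finset.univ : Finset (Fin 14)), ∀ z ∈ (Finset.univ : Finset (Fin 14)),
      y ≠ z → Disjoint (B y).offDiag (B z).offDiag := by
    intro y _ z _ hyz
    rw [Finset.disjoint_left]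
    rintro ⟨a, b⟩ h1 h2
    rw [Finset.mem_offDiag] at h1 h2
    exact hno a b y z h1.2.2 hyz h1.1 h1.2.1 h2.1 h2.2.1
  have hU := Finset.card_biUnion hdis
  have hsub : (Finset.univ.biUnion fun y => (B y).offDiag)
      ⊆ (Finset.univ : Finset (Fin 10)).offDiag := by
    intro p hp
    simp only [Finset.mem_biUnion, Finset.mem_offDiag] at hp ⊢
    obtain ⟨y, _, h⟩ := hp
    exact ⟨Finset.mem_univ _, Finset.mem_univ _, h.2.2⟩
  have h90 : (Finset.univ : Finset (Fin 10)).offDiag.card = 90 := by decide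
  have hle := Finset.card_le_card hsub
  rw [h90, hU] at hle
  simp only [Finset.offDiag_card] at hle hU
  -- pass to integers
  have key : ∀ d : ℕ, ((d * d - d : ℕ) : ℤ) = 6 * d - 12 + ((d : ℤ) - 3) * ((d : ℤ) - 4) := by
    intro d
    rw [Nat.cast_sub (Nat.le_mul_self d)]
    push_cast
    ring
  have hnn : ∀ d : ℕ, 0 ≤ ((d : ℤ) - 3) * ((d : ℤ) - 4) := by
    intro d
    rcases le_or_gt d 3 with h | h
    · have : (d : ℤ) ≤ 3 := by exact_mod_cast h
      nlinarith
    · have : (4 : ℤ) ≤ d := by exact_mod_cast h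
      nlinarith
  have hleZ : (∑ y, (((B y).card * (B y).card - (B y).card : ℕ) : ℤ)) ≤ 90 := by
    exact_mod_cast hle
  have hsumZ : (∑ y, ((B y).card : ℤ)) = G.card := by exact_mod_cast hsum
  have hexp : (∑ y, (((B y).card * (B y).card - (B y).card : ℕ) : ℤ))
      = 6 * G.card - 168 + ∑ y, (((B y).card : ℤ) - 3) * (((B y).card : ℤ) - 4) := by
    simp only [key]
    rw [Finset.sum_add_distrib, Finset.sum_sub_distrib, ← Finset.mul_sum, hsumZ]
    simp
  have hS : 0 ≤ ∑ y, (((B y).card : ℤ) - 3) * (((B y).card : ℤ) - 4) :=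
    Finset.sum_nonneg (fun y _ => hnn _)
  have hGc : (43 : ℤ) ≤ G.card := by exact_mod_cast hcard
  have hG43 : G.card = 43 := by
    have : (G.card : ℤ) = 43 := by linarith
    exact_mod_cast this
  have hS0 : ∑ y, (((B y).card : ℤ) - 3) * (((B y).card : ℤ) - 4) = 0 := by linarith
  have h34 : ∀ y, (B y).card = 3 ∨ (B y).card = 4 := by
    intro y
    have := (Finset.sum_eq_zero_iff_of_nonneg (fun y _ => hnn (B y).card)).mp hS0 y
      (Finset.mem_univ y)
    rcases mul_eq_zero.mp this with h | h
    · left; omega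
    · right; omega
  have heq : (Finset.univ.biUnion fun y => (B y).offDiag)
      = (Finset.univ : Finset (Fin 10)).offDiag := by
    apply Finset.eq_of_subset_of_card_le hsub
    rw [h90, hU]
    have : (90 : ℤ) ≤ ∑ y, (((B y).card * (B y).card - (B y).card : ℕ) : ℤ) := by
      rw [hexp]; linarith
    exact_mod_cast this
  -- at most one block of size four
  have hfour : (Finset.univ.filter (fun y => (B y).card = 4)).card ≤ 1 := by
    have e : ∀ y, (B y).card = 3 + (if (B y).card = 4 then 1 else 0) := by
      intro y
      rcases h34 y with h | h <;> simp [h]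
    have h1 : ∑ y, (3 + (if (B y).card = 4 then 1 else 0)) = 43 := by
      rw [← hG43, ← hsum]
      exact Finset.sum_congr rfl (fun y _ => (e y).symm)
    rw [Finset.sum_add_distrib, ← Finset.card_filter] at h1
    simp only [Finset.sum_const, Finset.card_univ, Fintype.card_fin, smul_eq_mul] at h1
    omega
  obtain ⟨x, hx⟩ : ∃ x, ∀ y, x ∈ B y → (B y).card = 3 := by
    rcases Finset.eq_empty_or_nonempty (Finset.univ.filter (fun y => (B y).card = 4)) with h0 | h0
    · refine ⟨0, fun y _ => (h34 y).resolve_right (fun h => ?_)⟩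
      have : y ∈ Finset.univ.filter (fun y => (B y).card = 4) := by simp [h]
      rw [h0] at this
      simp at this
    · obtain ⟨y0, hy0⟩ := h0
      have hy4 : (B y0).card = 4 := (Finset.mem_filter.mp hy0).2
      obtain ⟨x, hx⟩ : ∃ x, x ∉ B y0 := by
        by_contra hall
        push Not at hall
        have : B y0 = Finset.univ := Finset.eq_univ_iff_forall.mpr hall
        rw [this] at hy4
        simp at hy4
      refine ⟨x, fun y hxy => (h34 y).resolve_right (fun h => ?_)⟩
      have hy : y ∈ Finset.univ.filter (fun y => (B y).card = 4) := by simp [h]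
      have := Finset.card_le_one.mp hfour y hy y0 hy0
      rw [this] at hxy
      exact hx hxy
  have hcov : ((Finset.univ.filter (fun y => x ∈ B y)).biUnion fun y => (B y).erase x)
      = Finset.univ.erase x := by
    ext z
    simp only [Finset.mem_biUnion, Finset.mem_filter, Finset.mem_univ, true_and, Finset.mem_erase,
      and_true]
    constructor
    · rintro ⟨y, _, h, _⟩; exact h
    · intro hz
      have : (x, z) ∈ (Finset.univ : Finset (Fin 10)).offDiag := by
        simp [Finset.mem_offDiag, Ne.symm hz]
      rw [← heq] at this
      simp only [Finset.mem_biUnion, Finset.mem_offDiag] at this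
      obtain ⟨y, _, h1, h2, _⟩ := this
      exact ⟨y, h1, hz, h2⟩
  have hc := congrArg Finset.card hcov
  rw [Finset.card_biUnion, Finset.card_erase_of_mem (Finset.mem_univ x)] at hc
  · have h2 : ∀ y ∈ Finset.univ.filter (fun y => x ∈ B y), ((B y).erase x).card = 2 := by
      intro y hy
      have hy' := (Finset.mem_filter.mp hy).2
      rw [Finset.card_erase_of_mem hy', hx y hy']
    rw [Finset.sum_congr rfl h2] at hc
    simp only [Finset.sum_const, Finset.card_univ, Fintype.card_fin, smul_eq_mul] at hc
    omega
  · intro y hy z hz hyz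
    have hy' := (Finset.mem_filter.mp hy).2
    have hz' := (Finset.mem_filter.mp hz).2
    show Disjoint ((B y).erase x) ((B z).erase x)
    rw [Finset.disjoint_left]
    intro w h1 h2
    rw [Finset.mem_erase] at h1 h2
    exact hno x w y z (Ne.symm h1.1) hyz hy' h1.2 hz' h2.2

/-! ### The second inequality -/

theorem noP {t : CTree} {s n : ℕ} {ps : List (ℕ × ℕ)}
    (h : check t [] (masksOf s) n ps = true) (R : List (Finset (Fin 10)))
    (hR : R.map Finset.card = expandP ((s, n) :: ps)) : ¬ R4 R := by
  intro h4
  exact Bad_cons_of_Inf (p := (s, n)) (check_sound t _ _ _ _ h) R hR (by simpa using h4)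

theorem R4.mono {R R' : List (Finset (Fin 10))} (h : List.Forall₂ (fun X Y => X ⊆ Y) R R')
    (h4 : R4 R) : R4 R' := by
  intro V hV
  refine le_trans ?_ (h4 V hV)
  clear h4
  induction h with
  | nil => simp
  | cons hab _ ih =>
    rw [List.countP_cons, List.countP_cons]
    apply Nat.add_le_add ih
    split_ifs with h1 h2
    · exact le_refl _
    · exfalso
      apply h2
      rw [decide_eq_true_eq] at h1 ⊢
      exact hab.trans h1
    · simp
    · simp

theorem pad {R : List (Finset (Fin 10))} {p : List ℕ}
    (h : List.Forall₂ (fun X k => X.card ≤ k) R p) (hp : ∀ k ∈ p, k ≤ 10) :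
    ∃ R' : List (Finset (Fin 10)), R'.map Finset.card = p ∧ List.Forall₂ (fun X Y => X ⊆ Y) R R' := by
  induction h with
  | nil => exact ⟨[], rfl, List.Forall₂.nil⟩
  | cons hab _ ih =>
    rename_i X k l1 l2 _
    obtain ⟨R', h1, h2⟩ := ih (fun j hj => hp j (by simp [hj]))
    obtain ⟨Y, hXY, hY⟩ := Finset.exists_superset_card_eq hab (by simpa using hp k (by simp))
    exact ⟨Y :: R', by simp [hY, h1], List.Forall₂.cons hXY h2⟩

theorem noPad {t : CTree} {s n : ℕ} {ps : List (ℕ × ℕ)}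
    (h : check t [] (masksOf s) n ps = true) (hp : ∀ k ∈ expandP ((s, n) :: ps), k ≤ 10)
    {L : List (Finset (Fin 10))} (h4 : R4 L) (j : ℕ) :
    ¬ List.Forall₂ (fun X k => X.card ≤ k) (L.take j) (expandP ((s, n) :: ps)) := by
  intro hf
  obtain ⟨R', h1, h2⟩ := pad hf hp
  exact noP h R' h1 (R4.mono h2 (R4.sub (List.take_sublist _ _) h4))

theorem sum_countP (R : List (Finset (Fin 10))) :
    ∑ p : Fin 10, R.countP (fun s => decide (p ∈ s)) = (R.map Finset.card).sum := by
  induction R with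
  | nil => simp
  | cons X R ih =>
    simp only [List.countP_cons, Finset.sum_add_distrib, ih, List.map_cons, List.sum_cons,
      decide_eq_true_eq]
    rw [← Finset.card_filter, Nat.add_comm]
    simp

theorem no_threes (R : List (Finset (Fin 10))) (hl : R.length = 14)
    (hc : ∀ X ∈ R, X.card = 3) : ¬ R4 R := by
  intro h4
  obtain ⟨p, hp⟩ : ∃ p : Fin 10, 5 ≤ R.countP (fun s => decide (p ∈ s)) := by
    by_contra hno
    push Not at hno
    have h1 := sum_countP R
    have h2 : R.map Finset.card = List.replicate 14 3 := by
      rw [List.eq_replicate_iff]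
      refine ⟨by simpa using hl, fun b hb => ?_⟩
      obtain ⟨X, hX, rfl⟩ := List.mem_map.mp hb
      exact hc X hX
    rw [h2] at h1
    have h3 : ∑ p : Fin 10, R.countP (fun s => decide (p ∈ s)) ≤ ∑ _p : Fin 10, 4 :=
      Finset.sum_le_sum (fun p _ => by have := hno p; omega)
    rw [h1] at h3
    revert h3
    simp
  let σ : Equiv.Perm (Fin 10) := Equiv.swap 0 p
  have h4' := R4.map σ h4
  set R' := R.map (fun s => s.map σ.toEmbedding) with hR'
  have hl' : R'.length = 14 := by simp [hR', hl]
  have hc' : ∀ X ∈ R', X.card = 3 := by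
    intro X hX
    obtain ⟨Y, hY, rfl⟩ := List.mem_map.mp hX
    simpa using hc Y hY
  have hp' : 5 ≤ (R'.filter (fun s => decide ((0 : Fin 10) ∈ s))).length := by
    rw [← List.countP_eq_length_filter, hR', List.countP_map]
    refine le_trans hp (List.countP_mono_left ?_)
    intro s _ hs
    simp only [Function.comp, decide_eq_true_eq] at hs ⊢
    rw [Finset.mem_map_equiv]
    simpa [σ] using hs
  set F := (R'.filter (fun s => decide ((0 : Fin 10) ∈ s))).take 5 with hF
  have hFs : F.Sublist R' := (List.take_sublist _ _).trans List.filter_sublist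
  have hFl : F.length = 5 := by rw [hF, List.length_take]; omega
  have hF0 : ∀ X ∈ F, (0 : Fin 10) ∈ X := by
    intro X hX
    have := (List.mem_filter.mp (List.mem_of_mem_take hX)).2
    simpa using this
  obtain ⟨rest, hrest⟩ := hFs.exists_perm_append
  have h4F : R4 (F ++ rest) := R4.perm hrest h4'
  have hrl : rest.length = 9 := by
    have := hrest.length_eq
    rw [List.length_append] at this
    omega
  have hrc : ∀ X ∈ rest, X.card = 3 := fun X hX =>
    hc' X (hrest.symm.subset (List.mem_append_right _ hX))
  obtain ⟨T, hT, hTm⟩ := exists_dec_list 3 F (fun X hX => hc' X (hFs.subset hX))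
  have hI := check_sound _ _ _ _ _ crt_u
  refine hI T ?_ ?_ rest ?_ ?_
  · rw [← hFl, ← hT, List.length_map]
  · intro t ht
    refine List.mem_filter.mpr ⟨hTm t ht, ?_⟩
    have h0 : (0 : Fin 10) ∈ dec t := hF0 _ (by rw [← hT]; exact List.mem_map_of_mem ht)
    simp only [dec, Finset.mem_filter, Finset.mem_univ, true_and] at h0
    have h1 : t % 2 = 1 := by simpa [Nat.testBit_zero] using h0
    exact Nat.beq_eq.mpr h1
  · have : expandP [(3, 9)] = List.replicate 9 3 := rfl
    rw [this, List.eq_replicate_iff]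
    refine ⟨by simpa using hrl, fun b hb => ?_⟩
    obtain ⟨X, hX, rfl⟩ := List.mem_map.mp hb
    exact hrc X hX
  · rw [List.append_nil, hT]
    exact h4F

theorem no_threes_pad {L : List (Finset (Fin 10))} (h4 : R4 L) :
    ¬ List.Forall₂ (fun X k => X.card ≤ k) L (List.replicate 14 3) := by
  intro hf
  obtain ⟨R', h1, h2⟩ := pad hf (by
    intro k hk
    rw [List.eq_of_mem_replicate hk]
    norm_num)
  refine no_threes R' ?_ ?_ (R4.mono h2 h4)
  · have := congrArg List.length h1
    simpa using this
  · intro X hX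
    have : X.card ∈ R'.map Finset.card := List.mem_map_of_mem hX
    rw [h1] at this
    exact List.eq_of_mem_replicate this

set_option maxHeartbeats 4000000 in
theorem arith (a b c d e f g h i j k l m n : ℕ)
    (s : a ≤ b ∧ b ≤ c ∧ c ≤ d ∧ d ≤ e ∧ e ≤ f ∧ f ≤ g ∧ g ≤ h ∧ h ≤ i ∧ i ≤ j ∧ j ≤ k ∧ k ≤ l
      ∧ l ≤ m ∧ m ≤ n)
    (hs : a + b + c + d + e + f + g + h + i + j + k + l + m + n ≤ 42)
    (hu : ¬ (n ≤ 3))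
    (ha : ¬ (a ≤ 2 ∧ m ≤ 3 ∧ n ≤ 4))
    (hb : ¬ (a ≤ 1 ∧ l ≤ 3 ∧ n ≤ 4))
    (hc : ¬ (a ≤ 1 ∧ m ≤ 3 ∧ n ≤ 5))
    (hd : ¬ (b ≤ 2 ∧ l ≤ 3))
    (he : ¬ (c ≤ 2 ∧ k ≤ 3))
    (hf : ¬ (d ≤ 2 ∧ j ≤ 3))
    (hg : ¬ (e ≤ 2 ∧ i ≤ 3))
    (hh : ¬ (f ≤ 2))
    (hi : ¬ (b ≤ 1 ∧ j ≤ 3 ∧ k ≤ 4))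
    (hj : ¬ (a ≤ 1 ∧ b ≤ 2 ∧ k ≤ 3))
    (hk : ¬ (a ≤ 1 ∧ c ≤ 2 ∧ j ≤ 3))
    (hl : ¬ (a ≤ 1 ∧ d ≤ 2 ∧ i ≤ 3))
    (hm : ¬ (a ≤ 1 ∧ e ≤ 2 ∧ h ≤ 3))
    (hn : ¬ (b ≤ 1 ∧ c ≤ 2 ∧ g ≤ 3))
    (ho : ¬ (b ≤ 1 ∧ d ≤ 2))
    (hp : ¬ (c ≤ 1 ∧ d ≤ 3))
    (hq : ¬ (a ≤ 0 ∧ h ≤ 3))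
    (hr : ¬ (a ≤ 0 ∧ d ≤ 2)) : False := by
  obtain ⟨s1, s2, s3, s4, s5, s6, s7, s8, s9, s10, s11, s12, s13⟩ := s
  have a3 : a ≤ 3 := by omega
  have b3 : b ≤ 3 := by omega
  have c3 : c ≤ 3 := by omega
  have h3f : 3 ≤ f := by omega
  have d3 : d ≤ 3 := by omega
  have e4 : e ≤ 4 := by omega
  rcases (by omega : a = 0 ∨ a = 1 ∨ a = 2 ∨ a = 3) with rfl | rfl | rfl | rfl <;>
  rcases (by omega : b = 0 ∨ b = 1 ∨ b = 2 ∨ b = 3) with rfl | rfl | rfl | rfl <;>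
  norm_num at * <;>
  rcases (by omega : c = 0 ∨ c = 1 ∨ c = 2 ∨ c = 3) with rfl | rfl | rfl | rfl <;>
  norm_num at * <;>
  rcases (by omega : d = 0 ∨ d = 1 ∨ d = 2 ∨ d = 3) with rfl | rfl | rfl | rfl <;>
  norm_num at * <;>
  rcases (by omega : e = 0 ∨ e = 1 ∨ e = 2 ∨ e = 3 ∨ e = 4) with rfl | rfl | rfl | rfl | rfl <;>
  norm_num at * <;>
  omega

set_option maxHeartbeats 4000000 in
theorem no_list (L : List (Finset (Fin 10))) (hl : L.length = 14)
    (hsum : (L.map Finset.card).sum ≤ 42) : ¬ R4 L := by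
  intro h40
  let S := L.mergeSort (fun a b => decide (a.card ≤ b.card))
  have hperm : S.Perm L := List.mergeSort_perm _ _
  have hsort : S.Pairwise (fun a b => decide (a.card ≤ b.card) = true) := by
    apply List.pairwise_mergeSort
    · intro a b c h1 h2
      simp only [decide_eq_true_eq] at *
      omega
    · intro a b
      simp only [Bool.or_eq_true, decide_eq_true_eq]
      omega
  have h4 : R4 S := R4.perm hperm.symm h40
  have hsS : (S.map Finset.card).sum ≤ 42 := by
    rw [(hperm.map Finset.card).sum_eq]; exact hsum
  have hlS : S.length = 14 := by rw [hperm.length_eq, hl]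
  clear_value S
  have s : ∀ i j (hi : i < 14) (hj : j < 14), i ≤ j →
      (S[i]'(by omega)).card ≤ (S[j]'(by omega)).card := by
    intro i j hi hj hij
    rcases Nat.lt_or_eq_of_le hij with h | h
    · have := List.pairwise_iff_getElem.mp hsort i j (by omega) (by omega) h
      simpa using this
    · subst h; exact le_refl _
  clear hsort hperm hsum hl h40
  match S, hlS, s, h4, hsS with
  | [x0, x1, x2, x3, x4, x5, x6, x7, x8, x9, x10, x11, x12, x13], _, s, h4, hsS =>
    have t0 : x0.card ≤ x1.card :=
      s 0 1 (by norm_num) (by norm_num) (by norm_num)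
    have t1 : x1.card ≤ x2.card :=
      s 1 2 (by norm_num) (by norm_num) (by norm_num)
    have t2 : x2.card ≤ x3.card :=
      s 2 3 (by norm_num) (by norm_num) (by norm_num)
    have t3 : x3.card ≤ x4.card :=
      s 3 4 (by norm_num) (by norm_num) (by norm_num)
    have t4 : x4.card ≤ x5.card :=
      s 4 5 (by norm_num) (by norm_num) (by norm_num)
    have t5 : x5.card ≤ x6.card :=
      s 5 6 (by norm_num) (by norm_num) (by norm_num)
    have t6 : x6.card ≤ x7.card :=
      s 6 7 (by norm_num) (by norm_num) (by norm_num)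
    have t7 : x7.card ≤ x8.card :=
      s 7 8 (by norm_num) (by norm_num) (by norm_num)
    have t8 : x8.card ≤ x9.card :=
      s 8 9 (by norm_num) (by norm_num) (by norm_num)
    have t9 : x9.card ≤ x10.card :=
      s 9 10 (by norm_num) (by norm_num) (by norm_num)
    have t10 : x10.card ≤ x11.card :=
      s 10 11 (by norm_num) (by norm_num) (by norm_num)
    have t11 : x11.card ≤ x12.card :=
      s 11 12 (by norm_num) (by norm_num) (by norm_num)
    have t12 : x12.card ≤ x13.card :=
      s 12 13 (by norm_num) (by norm_num) (by norm_num)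
    clear s
    simp only [List.map_cons, List.map_nil, List.sum_cons, List.sum_nil] at hsS
    have qu := no_threes_pad h4
    have qa := noPad crt_a (by decide) h4 14
    have qb := noPad crt_b (by decide) h4 14
    have qc := noPad crt_c (by decide) h4 14
    have qd := noPad crt_d (by decide) h4 12
    have qe := noPad crt_e (by decide) h4 11
    have qf := noPad crt_f (by decide) h4 10
    have qg := noPad crt_g (by decide) h4 9
    have qh := noPad crt_h (by decide) h4 6
    have qi := noPad crt_i (by decide) h4 11
    have qj := noPad crt_j (by decide) h4 11
    have qk := noPad crt_k (by decide) h4 10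
    have ql := noPad crt_l (by decide) h4 9
    have qm := noPad crt_m (by decide) h4 8
    have qn := noPad crt_n (by decide) h4 7
    have qo := noPad crt_o (by decide) h4 4
    have qp := noPad crt_p (by decide) h4 4
    have qq' := noPad crt_q (by decide) h4 8
    have qr := noPad crt_r (by decide) h4 4
    simp only [expandP, List.replicate, List.cons_append, List.nil_append,
      List.take_succ_cons, List.take_zero, List.forall₂_cons, List.forall₂_nil_left_iff, and_true]
      at qu qa qb qc qd qe qf qg qh qi qj qk ql qm qn qo qp qq' qr
    clear h4
    refine arith x0.card x1.card x2.card x3.card x4.card x5.card x6.card x7.card x8.card x9.card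
      x10.card x11.card x12.card x13.card ⟨t0, t1, t2, t3, t4, t5, t6, t7, t8, t9, t10, t11, t12⟩
      (by omega) (fun h => qu ?_) (fun h => qa ?_) (fun h => qb ?_) (fun h => qc ?_)
      (fun h => qd ?_) (fun h => qe ?_) (fun h => qf ?_) (fun h => qg ?_) (fun h => qh ?_)
      (fun h => qi ?_) (fun h => qj ?_) (fun h => qk ?_) (fun h => ql ?_) (fun h => qm ?_)
      (fun h => qn ?_) (fun h => qo ?_) (fun h => qp ?_) (fun h => qq' ?_) (fun h => qr ?_)
    all_goals
      clear qu qa qb qc qd qe qf qg qh qi qj qk ql qm qn qo qp qq' qr hsS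
      refine ⟨?_, ?_⟩ <;> (repeat' apply And.intro) <;> omega

theorem part_two (G : Finset (Fin 10 × Fin 14)) (hG : ¬ ContainsK 10 14 4 4 G) :
    G.card ≤ 97 := by
  by_contra hcard
  push Not at hcard
  let f : Fin 14 → Finset (Fin 10) := fun y => Finset.univ.filter (fun x => (x, y) ∉ G)
  have hf : ∀ x y, x ∈ f y ↔ (x, y) ∉ G := by intro x y; simp [f]
  have hsum : ∑ y, (f y).card = Gᶜ.card := by
    rw [Finset.card_eq_sum_card_fiberwise (s := Gᶜ) (f := Prod.snd) (t := Finset.univ) (by simp)]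
    apply Finset.sum_congr rfl
    intro y _
    apply Finset.card_bij (fun x _ => (x, y))
    · intro x hx; simpa [hf] using hx
    · intro a _ b _ h; simpa using h
    · rintro ⟨x, y'⟩ h
      simp only [Finset.mem_filter, Finset.mem_compl] at h
      obtain ⟨h1, rfl⟩ := h
      exact ⟨x, (hf _ _).mpr h1, rfl⟩
  have hcc : Gᶜ.card ≤ 42 := by
    rw [Finset.card_compl]
    simp only [Fintype.card_prod, Fintype.card_fin]
    omega
  refine no_list ((List.finRange 14).map f) (by simp) ?_ ?_
  · rw [List.map_map]
    have : ((List.finRange 14).map (Finset.card ∘ f)).sum = ∑ y, (f y).card :=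
      (Fin.sum_univ_def (fun y => (f y).card)).symm
    rw [this, hsum]
    exact hcc
  · intro V hV
    by_contra hlt
    push Not at hlt
    rw [List.countP_map] at hlt
    have hcount : (List.finRange 14).countP ((fun s => decide (s ⊆ V)) ∘ f)
        = (Finset.univ.filter (fun y => f y ⊆ V)).card := by
      rw [List.countP_eq_length_filter]
      rfl
    rw [hcount] at hlt
    obtain ⟨B, hB, hB4⟩ := Finset.exists_subset_card_eq (Nat.succ_le_of_lt hlt)
    apply hG
    refine ⟨Vᶜ, B, ?_, hB4, ?_⟩
    · rw [Finset.card_compl, hV]; simp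
    · intro x hx y hy
      have hyV := (Finset.mem_filter.mp (hB hy)).2
      by_contra hxy
      exact Finset.mem_compl.mp hx (hyV ((hf x y).mpr hxy))

/-- z((10,14), K_{2,2}) ≤ 42 and z((10,14), K_{4,4}) ≤ 97. -/
theorem zarankiewicz_10_14 :
    (∀ G : Finset (Fin 10 × Fin 14), ¬ ContainsK 10 14 2 2 G → G.card ≤ 42) ∧
    (∀ G : Finset (Fin 10 × Fin 14), ¬ ContainsK 10 14 4 4 G → G.card ≤ 97) := by
  exact ⟨part_one, part_two⟩
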